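/- arXiv:1609.02468 — 8 statements merged into one kernel-verified Lean document; each statement's English description precedes it below -/
import Mathlib

section
/- Let Z := sup{z₁ ∈ ℝ : there exists z₂ with (z₁,z₂) in the support of ω₀}. Then for every z₁ < Z, Φ(z₁,t) → ∞ as t → ∞. -/
open MeasureTheory Real

/-- `IsGlobalSolution ω₀ Φ`: `Φ` is a global solution of the hyperbolic 2D Euler
equation in `z`-coordinates with data `ω₀`: it is continuous on `ℝ × [0,∞)`, bounded
on `ℝ × [0,T]` for every `T > 0`, and with `ω(z₁,z₂,t) := ω₀(z₁, z₂ - Φ(z₁,t))` it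
satisfies `Φ(z₁,t) = (1/2)∫₀ᵗ ∫_{z₁}^∞ ∫_ℝ ω(z̃₁,z₂,s)/cosh(z₂) dz₂ dz̃₁ ds`. -/
def IsGlobalSolution (ω₀ : ℝ × ℝ → ℝ) (Φ : ℝ → ℝ → ℝ) : Prop :=
  ContinuousOn (fun p : ℝ × ℝ => Φ p.1 p.2) (Set.univ ×ˢ Set.Ici (0:ℝ)) ∧
  (∀ T : ℝ, 0 < T → ∃ M, ∀ z₁ : ℝ, ∀ t ∈ Set.Icc (0:ℝ) T, |Φ z₁ t| ≤ M) ∧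
  ∀ (z₁ t : ℝ), 0 ≤ t →
    Φ z₁ t = (1 / 2) * ∫ s in (0:ℝ)..t, ∫ w in Set.Ioi z₁, ∫ z₂ : ℝ,
      ω₀ (w, z₂ - Φ w s) / Real.cosh z₂

/-- The velocity amplitude
`Ω(z₁,t) = (1/4)∫_{z₁}^∞ ∫_ℝ ω₀(z̃₁, z₂ - Φ(z̃₁,t))/cosh(z₂) dz₂ dz̃₁`. -/
noncomputable def Omeg (ω₀ : ℝ × ℝ → ℝ) (Φ : ℝ → ℝ → ℝ) (z₁ t : ℝ) : ℝ :=
  (1 / 4) * ∫ w in Set.Ioi z₁, ∫ z₂ : ℝ, ω₀ (w, z₂ - Φ w t) / Real.cosh z₂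

/-- Let `Z = sup{z₁ : ∃ z₂, (z₁,z₂) ∈ supp ω₀}`. Then for every `z₁ < Z`,
`Φ(z₁,t) → ∞` as `t → ∞`. -/
theorem stmt_10 (K : ℝ) (hK : 0 < K) (ω₀ : ℝ × ℝ → ℝ)
    (hcont : Continuous ω₀) (hbdd : ∃ M, ∀ z, |ω₀ z| ≤ M)
    (hpos : ∀ z, 0 ≤ ω₀ z) (hne : ∃ z, ω₀ z ≠ 0)
    (hsupp : ∀ z : ℝ × ℝ, ω₀ z ≠ 0 → |z.1 - z.2| ≤ K ∧ z.1 + z.2 ≤ K)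
    (Φ : ℝ → ℝ → ℝ) (hΦ : IsGlobalSolution ω₀ Φ) :
    ∀ z₁ : ℝ, z₁ < sSup {w : ℝ | ∃ z₂, (w, z₂) ∈ Function.support ω₀} →
      Filter.Tendsto (fun t => Φ z₁ t) Filter.atTop Filter.atTop := by
  intro A hA
  obtain ⟨hΦc, -, hΦe⟩ := hΦ
  obtain ⟨z, hz⟩ := hne
  obtain ⟨w₀, ⟨y₀, hwy⟩, hAw⟩ := exists_lt_of_lt_csSup (by exact ⟨z.1, z.2, hz⟩) hA
  obtain ⟨h1, h2⟩ := hsupp _ hwy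
  simp only [abs_le] at h1 h2
  have hAK : A < K := by linarith
  have hcosh : ∀ x : ℝ, Real.cosh x ≠ 0 := fun x => (Real.cosh_pos x).ne'
  have hΨ : Continuous (fun p : ℝ × ℝ => Φ p.1 (max p.2 0)) :=
    hΦc.comp_continuous (f := fun p : ℝ × ℝ => (p.1, max p.2 0)) (by fun_prop) fun p => by simp
  set g : ℝ → ℝ → ℝ := fun w s =>
    ∫ y in (A - K - 1)..(2 * K), ω₀ (w, y) / Real.cosh (y + Φ w (max s 0)) with hg
  have hle : A - K - 1 ≤ 2 * K := by linarith
  have hker : Continuous (fun p : (ℝ × ℝ) × ℝ =>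
      ω₀ (p.1.1, p.2) / Real.cosh (p.2 + Φ p.1.1 (max p.1.2 0))) := by
    refine (hcont.comp (by fun_prop)).div
      (Real.continuous_cosh.comp (continuous_snd.add (hΨ.comp continuous_fst))) fun p => hcosh _
  have hgc : Continuous (fun p : ℝ × ℝ => g p.1 p.2) :=
    intervalIntegral.continuous_parametric_intervalIntegral_of_continuous'
      (f := fun p : ℝ × ℝ => fun y => ω₀ (p.1, y) / Real.cosh (y + Φ p.1 (max p.2 0))) hker _ _
  have hg0 : ∀ w s, 0 ≤ g w s := fun w s =>
    intervalIntegral.integral_nonneg hle fun y _ => div_nonneg (hpos _) (Real.cosh_pos _).le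
  have hgK : ∀ w s, K < w → g w s = 0 := fun w s hw => by
    have hz : ∀ y, ω₀ (w, y) = 0 := fun y => by
      by_contra h
      obtain ⟨h1, h2⟩ := hsupp _ h
      simp only [abs_le] at h1 h2
      linarith
    simp [hg, hz]
  have hG : ∀ w s, A ≤ w → 0 ≤ s →
      ∫ z₂ : ℝ, ω₀ (w, z₂ - Φ w s) / Real.cosh z₂ = g w s := fun w s hw hs => by
    have h := integral_sub_right_eq_self (μ := volume)
      (fun y => ω₀ (w, y) / Real.cosh (y + Φ w s)) (Φ w s)
    simp only [sub_add_cancel] at h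
    rw [h, hg]
    simp only [max_eq_left hs]
    rw [intervalIntegral.integral_of_le hle, setIntegral_eq_integral_of_forall_compl_eq_zero]
    intro y hy
    suffices ω₀ (w, y) = 0 by simp [this]
    by_contra h
    obtain ⟨h1, h2⟩ := hsupp _ h
    simp only [abs_le] at h1 h2
    exact hy ⟨by linarith, by linarith⟩
  have hF : ∀ a s, A ≤ a → a ≤ K → 0 ≤ s →
      ∫ w in Set.Ioi a, ∫ z₂ : ℝ, ω₀ (w, z₂ - Φ w s) / Real.cosh z₂ = ∫ w in a..K, g w s := by
    intro a s ha haK hs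
    rw [setIntegral_congr_fun measurableSet_Ioi fun w (hw : a < w) => hG w s (ha.trans hw.le) hs,
      intervalIntegral.integral_of_le haK]
    refine setIntegral_eq_of_subset_of_forall_sdiff_eq_zero measurableSet_Ioi
      Set.Ioc_subset_Ioi_self fun w hw => hgK w s ?_
    by_contra h
    exact hw.2 ⟨hw.1, not_lt.1 h⟩
  have hFc : ∀ a, Continuous (fun s => ∫ w in a..K, g w s) := fun a =>
    intervalIntegral.continuous_parametric_intervalIntegral_of_continuous'
      (f := fun s w => g w s) (hgc.comp (by fun_prop : Continuous fun p : ℝ × ℝ => (p.2, p.1))) _ _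
  have hgi : ∀ s a b, IntervalIntegrable (fun w => g w s) volume a b := fun s a b =>
    (hgc.comp (by fun_prop : Continuous fun w : ℝ => (w, s))).intervalIntegrable _ _
  have hΦ' : ∀ a t, A ≤ a → a ≤ K → 0 ≤ t →
      Φ a t = 1 / 2 * ∫ s in (0 : ℝ)..t, ∫ w in a..K, g w s := fun a t ha haK ht => by
    rw [hΦe a t ht]
    congr 1
    refine intervalIntegral.integral_congr fun s hs => hF a s ha haK ?_
    rw [Set.uIcc_of_le ht] at hs
    exact hs.1
  have hF0 : ∀ a s, a ≤ K → 0 ≤ ∫ w in a..K, g w s := fun a s ha =>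
    intervalIntegral.integral_nonneg ha fun w _ => hg0 w s
  have hΦ0 : ∀ a t, A ≤ a → a ≤ K → 0 ≤ t → 0 ≤ Φ a t := fun a t ha haK ht => by
    rw [hΦ' a t ha haK ht]
    exact mul_nonneg (by norm_num) (intervalIntegral.integral_nonneg ht fun s _ => hF0 a s haK)
  have hΦle : ∀ a s t, A ≤ a → a ≤ K → 0 ≤ s → s ≤ t → Φ a s ≤ Φ A t := by
    intro a s t ha haK hs hst
    rw [hΦ' a s ha haK hs, hΦ' A t le_rfl hAK.le (hs.trans hst)]
    refine mul_le_mul_of_nonneg_left ?_ (by norm_num)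
    calc ∫ r in (0 : ℝ)..s, ∫ w in a..K, g w r
        ≤ ∫ r in (0 : ℝ)..s, ∫ w in A..K, g w r :=
          intervalIntegral.integral_mono_on hs ((hFc a).intervalIntegrable _ _)
            ((hFc A).intervalIntegrable _ _) fun r _ =>
            intervalIntegral.integral_mono_interval ha haK le_rfl
              (ae_of_all _ fun w => hg0 w r) (hgi _ _ _)
      _ ≤ ∫ r in (0 : ℝ)..t, ∫ w in A..K, g w r :=
          intervalIntegral.integral_mono_interval le_rfl hs hst
            (ae_of_all _ fun r => hF0 A r hAK.le) ((hFc A).intervalIntegrable _ _)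
  refine Filter.tendsto_atTop.2 fun b => ?_
  set k : ℝ → ℝ → ℝ := fun w y => ω₀ (w, y) / Real.cosh (|y| + b) with hk
  have hkc : Continuous (fun p : ℝ × ℝ => k p.1 p.2) :=
    hcont.div (Real.continuous_cosh.comp (by fun_prop)) fun p => hcosh _
  have hk0 : ∀ w y, 0 ≤ k w y := fun w y => div_nonneg (hpos _) (Real.cosh_pos _).le
  have hkyc : ∀ w, Continuous (k w) := fun w => hkc.comp (by fun_prop : Continuous fun y : ℝ => (w, y))
  set h : ℝ → ℝ := fun w => ∫ y in (A - K - 1)..(2 * K), k w y with hh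
  have hhc : Continuous h :=
    intervalIntegral.continuous_parametric_intervalIntegral_of_continuous' hkc _ _
  have hh0 : 0 < h w₀ :=
    intervalIntegral.integral_pos (by linarith) (hkyc w₀).continuousOn (fun y _ => hk0 _ y)
      ⟨y₀, ⟨by linarith, by linarith⟩,
        div_pos ((hpos _).lt_of_ne' hwy) (Real.cosh_pos _)⟩
  set c : ℝ := ∫ w in A..K, h w
  have hc : 0 < c :=
    intervalIntegral.integral_pos hAK hhc.continuousOn
      (fun w _ => intervalIntegral.integral_nonneg hle fun y _ => hk0 w y)
      ⟨w₀, ⟨hAw.le, by linarith⟩, hh0⟩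
  filter_upwards [Filter.eventually_ge_atTop (0 : ℝ), Filter.eventually_ge_atTop (2 * b / c)]
    with t ht htb
  by_contra! hlt
  have hgh : ∀ s ∈ Set.Icc 0 t, c ≤ ∫ w in A..K, g w s := by
    intro s hs
    refine intervalIntegral.integral_mono_on hAK.le (hhc.intervalIntegrable _ _) (hgi _ _ _) ?_
    intro w hw
    refine intervalIntegral.integral_mono_on hle ((hkyc w).intervalIntegrable _ _)
      ((hker.comp (by fun_prop :
        Continuous fun y : ℝ => ((w, s), y))).intervalIntegrable _ _) ?_
    intro y _
    have h0 := hΦ0 w s hw.1 hw.2 hs.1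
    have h1 := hΦle w s t hw.1 hw.2 hs.1 hs.2
    simp only [hk, max_eq_left hs.1]
    refine div_le_div_of_nonneg_left (hpos _) (Real.cosh_pos _) (Real.cosh_le_cosh.2 ?_)
    rw [abs_of_nonneg (by linarith [abs_nonneg y] : 0 ≤ |y| + b)]
    exact (abs_add_le _ _).trans (by rw [abs_of_nonneg h0]; linarith)
  have hint : t * c ≤ ∫ s in (0 : ℝ)..t, ∫ w in A..K, g w s := by
    have := intervalIntegral.integral_mono_on ht (intervalIntegrable_const (μ := volume) (c := c))
      ((hFc A).intervalIntegrable _ _) hgh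
    simpa using this
  rw [hΦ' A t le_rfl hAK.le ht] at hlt
  rw [div_le_iff₀ hc] at htb
  linarith
end

section
/- For every z₁ ∈ ℝ one has the identity ∫_{ℝ} ω̃₀(z₁,z₂) dz₂ = 2 ∫₀^{∞} ω₀(x₁, e^{z₁}/x₁) dx₁/x₁, and there exist Z₁ ∈ ℝ and c > 0 such that ∫_{ℝ} ω̃₀(z₁,z₂) dz₂ ≥ c for every z₁ ≤ Z₁. -/
open MeasureTheory Real

/-- The change of variables `x = exp s` for integrals over the positive half-line. -/
lemma integral_comp_exp_eq_integral_Ioi_div (g : ℝ → ℝ) :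
    ∫ s : ℝ, g (Real.exp s) = ∫ x in Set.Ioi (0 : ℝ), g x / x := by
  have h := integral_image_eq_integral_abs_deriv_smul (s := Set.univ) (f := Real.exp)
    (f' := Real.exp) MeasurableSet.univ (fun x _ => (Real.hasDerivAt_exp x).hasDerivWithinAt)
    Real.exp_injective.injOn (fun x => g x / x)
  rw [Set.image_univ, Real.range_exp, setIntegral_univ] at h
  rw [h]
  refine integral_congr_ae (Filter.Eventually.of_forall fun s => ?_)
  have := Real.exp_pos s
  simp only [abs_of_pos this, smul_eq_mul]
  field_simp

/-- Along the hyperbola `x₁ x₂ = exp z`, the hyperbolic angle is minus twice `log x₁`, up to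
translation. -/
lemma integral_hyperbolic_eq_two_mul (f : ℝ × ℝ → ℝ) (z : ℝ) :
    ∫ t : ℝ, f (Real.exp ((z - t) / 2), Real.exp ((z + t) / 2)) =
      2 * ∫ s : ℝ, f (Real.exp s, Real.exp (z - s)) := by
  rw [← integral_sub_left_eq_self
    (fun t : ℝ => f (Real.exp ((z - t) / 2), Real.exp ((z + t) / 2))) volume z]
  have h := Measure.integral_comp_div (fun s : ℝ => f (Real.exp s, Real.exp (z - s))) 2
  rw [abs_two, smul_eq_mul] at h
  rw [← h]
  refine integral_congr_ae (Filter.Eventually.of_forall fun s => ?_)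
  have h₁ : (z - (z - s)) / 2 = s / 2 := by ring
  have h₂ : (z + (z - s)) / 2 = z - s / 2 := by ring
  simp only [h₁, h₂]

/-- A compactly supported continuous function vanishing for `x₁ < δ` is integrable along
the hyperbola `x₁ x₂ = exp z`. -/
lemma integrable_along_hyperbola {δ : ℝ} (hδ : 0 < δ) {f : ℝ × ℝ → ℝ}
    (hf : Continuous f) (hcs : HasCompactSupport f)
    (hsupp : ∀ x : ℝ × ℝ, f x ≠ 0 → δ ≤ x.1) (z : ℝ) :
    Integrable (fun s : ℝ => f (Real.exp s, Real.exp (z - s))) := by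
  obtain ⟨R, hR⟩ := (hcs.isCompact.image continuous_fst).bddAbove
  refine Continuous.integrable_of_hasCompactSupport (by fun_prop) ?_
  refine HasCompactSupport.intro (isCompact_Icc (a := Real.log δ) (b := Real.log R)) ?_
  intro s hs
  by_contra hne
  have h₁ : δ ≤ Real.exp s := hsupp _ hne
  have h₂ : Real.exp s ≤ R := hR ⟨_, subset_tsupport f hne, rfl⟩
  exact hs ⟨(Real.log_le_iff_le_exp hδ).2 h₁,
    (Real.le_log_iff_exp_le ((Real.exp_pos s).trans_le h₂)).2 h₂⟩

/-- If `f ≥ 0` is positive at some boundary point `(a, 0)` with `a > 0`, then its integrals along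
the hyperbolas `x₁ x₂ = exp z` are bounded below as `z → -∞`. -/
lemma exists_pos_le_integral_along_hyperbola {f : ℝ × ℝ → ℝ}
    (hf : Continuous f) (hpos : ∀ x, 0 ≤ f x)
    (hint : ∀ z : ℝ, Integrable (fun s : ℝ => f (Real.exp s, Real.exp (z - s))))
    {a : ℝ} (ha : 0 < a) (hfa : f (a, 0) ≠ 0) :
    ∃ Z c : ℝ, 0 < c ∧ ∀ z ≤ Z, c ≤ ∫ s : ℝ, f (Real.exp s, Real.exp (z - s)) := by
  have hm : 0 < f (a, 0) := (hpos _).lt_of_ne' hfa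
  have hcont : Continuous fun p : ℝ × ℝ => f (Real.exp p.1, p.2) := by fun_prop
  have hnhds : {p : ℝ × ℝ | f (a, 0) / 2 < f (Real.exp p.1, p.2)} ∈ nhds (Real.log a, (0 : ℝ)) :=
    (isOpen_lt continuous_const hcont).mem_nhds (by
      simp only [Set.mem_ofPred_eq, Real.exp_log ha]
      linarith)
  obtain ⟨r, hr, hball⟩ := Metric.mem_nhds_iff.1 hnhds
  refine ⟨Real.log r + (Real.log a - r), f (a, 0) / 2 * (2 * r), by positivity, fun z hz => ?_⟩
  have hlow : ∀ s ∈ Set.Ioo (Real.log a - r) (Real.log a + r),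
      f (a, 0) / 2 ≤ f (Real.exp s, Real.exp (z - s)) := by
    intro s hs
    have hexp : Real.exp (z - s) < r := by
      rw [← Real.lt_log_iff_exp_lt hr]
      linarith [hs.1]
    refine le_of_lt (hball (a := (s, Real.exp (z - s))) ?_)
    rw [← ball_prod_same, Real.ball_eq_Ioo, Real.ball_eq_Ioo]
    exact ⟨hs, by linarith [Real.exp_pos (z - s)], by simpa using hexp⟩
  calc f (a, 0) / 2 * (2 * r)
      = ∫ _ in Set.Ioo (Real.log a - r) (Real.log a + r), f (a, 0) / 2 := by
        rw [setIntegral_const, Real.volume_real_Ioo_of_le (by linarith), smul_eq_mul]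
        ring
    _ ≤ ∫ s in Set.Ioo (Real.log a - r) (Real.log a + r), f (Real.exp s, Real.exp (z - s)) :=
        setIntegral_mono_on (integrableOn_const (by simp)) (hint z).integrableOn
          measurableSet_Ioo hlow
    _ ≤ ∫ s : ℝ, f (Real.exp s, Real.exp (z - s)) :=
        setIntegral_le_integral (hint z) (Filter.Eventually.of_forall fun _ => hpos _)

open MeasureTheory Real

/-- In hyperbolic coordinates `ω̃₀(z₁,z₂) = ω₀(e^{(z₁-z₂)/2}, e^{(z₁+z₂)/2})` one has
`∫_ℝ ω̃₀(z₁,z₂) dz₂ = 2∫₀^∞ ω₀(x₁, e^{z₁}/x₁) dx₁/x₁`, and if `ω₀` does not vanish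
identically on the boundary segment `{x₂ = 0}` then this quantity is bounded below by
a positive constant for all sufficiently small `z₁`. -/
theorem stmt_11 (δ : ℝ) (hδ : 0 < δ) (ω₀ : ℝ × ℝ → ℝ)
    (hC1 : ContDiff ℝ 1 ω₀) (hpos : ∀ x, 0 ≤ ω₀ x)
    (hcs : HasCompactSupport ω₀)
    (hsupp : ∀ x : ℝ × ℝ, ω₀ x ≠ 0 → δ ≤ x.1)
    (hbdry : ∃ x₁ : ℝ, 0 < x₁ ∧ ω₀ (x₁, 0) ≠ 0) :
    (∀ z₁ : ℝ,
      (∫ z₂ : ℝ, ω₀ (Real.exp ((z₁ - z₂) / 2), Real.exp ((z₁ + z₂) / 2))) =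
        2 * ∫ x₁ in Set.Ioi (0:ℝ), ω₀ (x₁, Real.exp z₁ / x₁) / x₁) ∧
    ∃ Z₁ c : ℝ, 0 < c ∧ ∀ z₁ : ℝ, z₁ ≤ Z₁ →
      c ≤ ∫ z₂ : ℝ, ω₀ (Real.exp ((z₁ - z₂) / 2), Real.exp ((z₁ + z₂) / 2)) := by
  refine ⟨fun z => ?_, ?_⟩
  · rw [integral_hyperbolic_eq_two_mul,
      ← integral_comp_exp_eq_integral_Ioi_div (fun x => ω₀ (x, Real.exp z / x))]
    simp only [Real.exp_sub]
  · obtain ⟨a, ha, hωa⟩ := hbdry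
    obtain ⟨Z, c, hc, hle⟩ := exists_pos_le_integral_along_hyperbola hC1.continuous hpos
      (integrable_along_hyperbola hδ hC1.continuous hcs hsupp) ha hωa
    refine ⟨Z, 2 * c, by positivity, fun z hz => ?_⟩
    rw [integral_hyperbolic_eq_two_mul]
    linarith [hle z hz]
end

section
/- Suppose B ≥ 1, t ≥ 0 and z₁ ≤ Z₁ are such that H(z₁,t) ≤ −B and H(Z₁,t) ≥ 0, where H(z̃₁,t) := z̃₁ + Φ(z̃₁,t). Then Ω(z₁,t) ≥ γ, where γ := (c/4) e^{−K−1}; in particular γ > 0 depends only on ω₀ and not on B. -/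
open MeasureTheory Real

/-- If `f` is continuous and nonincreasing and `w + f w` passes from at most `-1` to at least `0` on
`[p, q]`, then it stays within `[-1, 0]` on some subinterval of length one. -/
theorem exists_unit_interval_add_mem_Icc {f : ℝ → ℝ} {p q : ℝ} (hf : Continuous f)
    (hanti : Antitone f) (hpq : p ≤ q) (hp : p + f p ≤ -1) (hq : 0 ≤ q + f q) :
    ∃ b, p ≤ b - 1 ∧ b ≤ q ∧ ∀ w ∈ Set.Icc (b - 1) b, w + f w ∈ Set.Icc (-1) (0 : ℝ) := by
  let S : Set ℝ := Set.Icc p q ∩ {w | 0 ≤ w + f w}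
  have hScpt : IsCompact S :=
    isCompact_Icc.inter_right (isClosed_le continuous_const (by fun_prop))
  obtain ⟨b, ⟨⟨hpb, hbq⟩, hb⟩, hmin⟩ := hScpt.exists_isLeast ⟨q, ⟨hpq, le_rfl⟩, hq⟩
  have hb : 0 ≤ b + f b := hb
  have hfb := hanti hpb
  have hneg : ∀ w, p ≤ w → w < b → w + f w ≤ 0 := by
    intro w hw hwb
    by_contra! h
    exact absurd (hmin ⟨⟨hw, (hwb.trans_le hbq).le⟩, h.le⟩) (not_le.mpr hwb)
  have hb0 : b + f b ≤ 0 := by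
    obtain ⟨x, ⟨hpx, hxb⟩, hx⟩ : (0 : ℝ) ∈ (fun w => w + f w) '' Set.Icc p b :=
      intermediate_value_Icc hpb (by fun_prop) ⟨by linarith, hb⟩
    have hx : x + f x = 0 := hx
    have hbx : b ≤ x := hmin ⟨⟨hpx, hxb.trans hbq⟩, hx.ge⟩
    rw [le_antisymm hbx hxb, hx]
  refine ⟨b, by linarith, hbq, fun w ⟨hw₁, hw₂⟩ => ⟨by linarith [hanti hw₂], ?_⟩⟩
  rcases hw₂.lt_or_eq with h | rfl
  · exact hneg w (by linarith) h
  · exact hb0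

/-- The hyperbolic cosine is bounded by the exponential of the absolute value. -/
theorem cosh_le_exp_of_abs_le {x R : ℝ} (hx : |x| ≤ R) : Real.cosh x ≤ Real.exp R := by
  obtain ⟨h₁, h₂⟩ := abs_le.mp hx
  rw [Real.cosh_eq]
  linarith [Real.exp_le_exp.mpr h₂, Real.exp_le_exp.mpr (neg_le.mp h₁)]

section Strip

variable {K : ℝ} {ω₀ : ℝ × ℝ → ℝ} {f : ℝ → ℝ}

theorem shifted_eq_zero_of_notMem (hsupp : ∀ z : ℝ × ℝ, ω₀ z ≠ 0 → |z.1 - z.2| ≤ K ∧ z.1 + z.2 ≤ K)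
    {w x : ℝ} (hx : x ∉ Set.Icc (w + f w - K) (w + f w + K)) : ω₀ (w, x - f w) = 0 := by
  by_contra h
  obtain ⟨h₁, h₂⟩ := abs_le.mp (hsupp _ h).1
  dsimp only at h₁ h₂
  exact hx ⟨by linarith, by linarith⟩

theorem integrable_shifted (hcont : Continuous ω₀)
    (hsupp : ∀ z : ℝ × ℝ, ω₀ z ≠ 0 → |z.1 - z.2| ≤ K ∧ z.1 + z.2 ≤ K) (w : ℝ) :
    Integrable fun x => ω₀ (w, x - f w) :=
  (by fun_prop : Continuous fun x => ω₀ (w, x - f w)).integrable_of_hasCompactSupport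
    (.intro isCompact_Icc fun _ hx => shifted_eq_zero_of_notMem hsupp hx)

theorem integrable_shifted_div_cosh (hcont : Continuous ω₀)
    (hsupp : ∀ z : ℝ × ℝ, ω₀ z ≠ 0 → |z.1 - z.2| ≤ K ∧ z.1 + z.2 ≤ K) (w : ℝ) :
    Integrable fun x => ω₀ (w, x - f w) / Real.cosh x := by
  have hc : Continuous fun x => ω₀ (w, x - f w) / Real.cosh x :=
    Continuous.div (by fun_prop) Real.continuous_cosh fun x => (Real.cosh_pos x).ne'
  exact hc.integrable_of_hasCompactSupport
    (.intro isCompact_Icc fun _ hx => by rw [shifted_eq_zero_of_notMem hsupp hx, zero_div])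

theorem integrableOn_Ioi_integral_shifted_div_cosh (hK : 0 ≤ K) (hcont : Continuous ω₀)
    (hrange : ∀ z, 0 ≤ ω₀ z ∧ ω₀ z ≤ 1)
    (hsupp : ∀ z : ℝ × ℝ, ω₀ z ≠ 0 → |z.1 - z.2| ≤ K ∧ z.1 + z.2 ≤ K)
    (hf : Continuous f) (a : ℝ) :
    IntegrableOn (fun w => ∫ x : ℝ, ω₀ (w, x - f w) / Real.cosh x) (Set.Ioi a) := by
  have hc : Continuous fun p : ℝ × ℝ => ω₀ (p.1, p.2 - f p.1) / Real.cosh p.2 :=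
    Continuous.div (by fun_prop) (Real.continuous_cosh.comp continuous_snd)
      fun p => (Real.cosh_pos _).ne'
  have hmeas : StronglyMeasurable fun w => ∫ x : ℝ, ω₀ (w, x - f w) / Real.cosh x :=
    hc.stronglyMeasurable.integral_prod_right'
  have hzero : ∀ w, K < w → ∫ x : ℝ, ω₀ (w, x - f w) / Real.cosh x = 0 := by
    intro w hw
    have : ∀ x, ω₀ (w, x - f w) = 0 := by
      intro x
      by_contra h
      have h₁ := (abs_le.mp (hsupp _ h).1).2
      have h₂ := (hsupp _ h).2
      dsimp only at h₁ h₂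
      linarith
    simp [this]
  have hbound : ∀ w, ‖∫ x : ℝ, ω₀ (w, x - f w) / Real.cosh x‖ ≤ 2 * K := by
    intro w
    rw [← setIntegral_eq_integral_of_forall_compl_eq_zero
      (s := Set.Icc (w + f w - K) (w + f w + K))
      fun x hx => by rw [shifted_eq_zero_of_notMem hsupp hx, zero_div]]
    refine (norm_setIntegral_le_of_norm_le_const (C := 1) (by simp) fun x _ => ?_).trans ?_
    · rw [Real.norm_of_nonneg (div_nonneg (hrange _).1 (Real.cosh_pos x).le)]
      exact div_le_one_of_le₀ ((hrange _).2.trans (Real.one_le_cosh x)) (Real.cosh_pos x).le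
    · rw [Real.volume_real_Icc_of_le (by linarith)]
      linarith
  have hIoc : IntegrableOn (fun w => ∫ x : ℝ, ω₀ (w, x - f w) / Real.cosh x) (Set.Ioc a K) :=
    Measure.integrableOn_of_bounded (M := 2 * K) (by simp)
      hmeas.aestronglyMeasurable (.of_forall hbound)
  refine hIoc.of_forall_sdiff_eq_zero measurableSet_Ioi fun w hw => hzero w ?_
  by_contra! h
  exact hw.2 ⟨hw.1, h⟩

theorem mul_exp_le_integral_shifted_div_cosh (hcont : Continuous ω₀)
    (hrange : ∀ z, 0 ≤ ω₀ z ∧ ω₀ z ≤ 1)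
    (hsupp : ∀ z : ℝ × ℝ, ω₀ z ≠ 0 → |z.1 - z.2| ≤ K ∧ z.1 + z.2 ≤ K)
    {w c : ℝ} (hlow : c ≤ ∫ y : ℝ, ω₀ (w, y)) (hw : w + f w ∈ Set.Icc (-1) (0 : ℝ)) :
    c * Real.exp (-K - 1) ≤ ∫ x : ℝ, ω₀ (w, x - f w) / Real.cosh x := by
  calc c * Real.exp (-K - 1)
      ≤ (∫ y : ℝ, ω₀ (w, y)) * Real.exp (-K - 1) := by gcongr
    _ = ∫ x : ℝ, ω₀ (w, x - f w) * Real.exp (-K - 1) := by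
      rw [integral_mul_const, integral_sub_right_eq_self (fun y => ω₀ (w, y))]
    _ ≤ ∫ x : ℝ, ω₀ (w, x - f w) / Real.cosh x := by
      refine integral_mono ((integrable_shifted hcont hsupp w).mul_const _)
        (integrable_shifted_div_cosh hcont hsupp w) fun x => ?_
      by_cases hx : x ∈ Set.Icc (w + f w - K) (w + f w + K)
      · have hcosh : Real.cosh x ≤ Real.exp (K + 1) :=
          cosh_le_exp_of_abs_le (abs_le.mpr ⟨by linarith [hx.1, hw.1], by linarith [hx.2, hw.2]⟩)
        rw [div_eq_mul_inv, show -K - 1 = -(K + 1) by ring, Real.exp_neg]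
        exact mul_le_mul_of_nonneg_left (inv_anti₀ (Real.cosh_pos x) hcosh) (hrange _).1
      · simp [shifted_eq_zero_of_notMem hsupp hx]

end Strip


/-- Lower bound on the velocity amplitude: if `H(z₁,t) = z₁ + Φ(z₁,t) ≤ -B ≤ -1`,
`z₁ ≤ Z₁` and `H(Z₁,t) ≥ 0`, then `Ω(z₁,t) ≥ γ = (c/4)e^{-K-1}`, a constant
depending only on `ω₀` and not on `B`. -/
theorem stmt_12 (K Z₁ c B t z₁ : ℝ) (hK : 0 < K) (hc : 0 < c)
    (ω₀ : ℝ × ℝ → ℝ) (hcont : Continuous ω₀)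
    (hrange : ∀ z, 0 ≤ ω₀ z ∧ ω₀ z ≤ 1)
    (hsupp : ∀ z : ℝ × ℝ, ω₀ z ≠ 0 → |z.1 - z.2| ≤ K ∧ z.1 + z.2 ≤ K)
    (hlow : ∀ w : ℝ, w ≤ Z₁ → c ≤ ∫ z₂ : ℝ, ω₀ (w, z₂))
    (Φ : ℝ → ℝ → ℝ) (hΦ : IsGlobalSolution ω₀ Φ)
    (hanti : ∀ s : ℝ, 0 ≤ s → ∀ a b : ℝ, a ≤ b → Φ b s ≤ Φ a s)
    (hB : 1 ≤ B) (ht : 0 ≤ t) (hz : z₁ ≤ Z₁)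
    (hH₁ : z₁ + Φ z₁ t ≤ -B) (hH₂ : 0 ≤ Z₁ + Φ Z₁ t) :
    (c / 4) * Real.exp (-K - 1) ≤ Omeg ω₀ Φ z₁ t := by
  have hf : Continuous fun w => Φ w t :=
    hΦ.1.comp_continuous (f := fun w : ℝ => (w, t)) (by fun_prop) fun w => ⟨trivial, ht⟩
  obtain ⟨b, hzb, hbZ, hb⟩ := exists_unit_interval_add_mem_Icc hf
    (fun a b h => hanti t ht a b h) hz (hH₁.trans (by linarith)) hH₂
  have hint := integrableOn_Ioi_integral_shifted_div_cosh hK.le hcont hrange hsupp hf z₁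
  have hsub : Set.Ioc (b - 1) b ⊆ Set.Ioi z₁ := fun w hw => hzb.trans_lt hw.1
  have hlower : c * Real.exp (-K - 1) ≤
      ∫ w in Set.Ioi z₁, ∫ z₂ : ℝ, ω₀ (w, z₂ - Φ w t) / Real.cosh z₂ := by
    calc c * Real.exp (-K - 1)
        = ∫ _ in Set.Ioc (b - 1) b, c * Real.exp (-K - 1) := by
          simp
      _ ≤ ∫ w in Set.Ioc (b - 1) b, ∫ z₂ : ℝ, ω₀ (w, z₂ - Φ w t) / Real.cosh z₂ :=
          setIntegral_mono_on (integrableOn_const (by simp)) (hint.mono_set hsub) measurableSet_Ioc fun w hw =>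
            mul_exp_le_integral_shifted_div_cosh (f := fun w => Φ w t) hcont hrange hsupp
              (hlow w (hw.2.trans hbZ)) (hb w ⟨hw.1.le, hw.2⟩)
      _ ≤ ∫ w in Set.Ioi z₁, ∫ z₂ : ℝ, ω₀ (w, z₂ - Φ w t) / Real.cosh z₂ :=
          setIntegral_mono_set hint
            (.of_forall fun w => integral_nonneg fun x =>
              div_nonneg (hrange _).1 (Real.cosh_pos x).le) hsub.eventuallyLE
  unfold Omeg
  linarith
end

section
/- Suppose at a time t ≥ 0 there are F ∈ ℝ, B ∈ ℝ and ε ∈ (0,1) such that H(z₁,t) ≤ −B − (1−ε)(F − z₁) for all z₁ ≤ F, where H(z₁,t) := z₁ + Φ(z₁,t). Then (1/4) ∫_{−∞}^{F} ∫_{ℝ} ω(z₁,z₂,t)/cosh(z₂) dz₂ dz₁ ≤ e^{K−B}/(1−ε); equivalently, lim_{z₁→−∞} Ω(z₁,t) − Ω(F,t) ≤ e^{K−B}/(1−ε). -/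
open MeasureTheory Real

theorem inv_cosh_le_two_mul_exp (x : ℝ) : 1 / Real.cosh x ≤ 2 * Real.exp x := by
  rw [div_le_iff₀ (Real.cosh_pos x), Real.cosh_eq]
  have h : Real.exp x * Real.exp (-x) = 1 := by rw [← Real.exp_add]; simp
  nlinarith [Real.exp_pos x]

/-- A density with values in `[0, 1]` that vanishes beyond `a` has integral at most `2 e^a`
against `1 / cosh`. -/
theorem integral_div_cosh_le (f : ℝ → ℝ) (a : ℝ) (h0 : ∀ x, 0 ≤ f x) (h1 : ∀ x, f x ≤ 1)
    (hsupp : ∀ x, f x ≠ 0 → x ≤ a) :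
    ∫ x, f x / Real.cosh x ≤ 2 * Real.exp a := by
  have hint : IntegrableOn (fun x => 2 * Real.exp x) (Set.Iic a) :=
    (integrableOn_exp_Iic a).const_mul 2
  calc ∫ x, f x / Real.cosh x
      ≤ ∫ x, (Set.Iic a).indicator (fun x => 2 * Real.exp x) x := by
        refine integral_mono_of_nonneg
          (.of_forall fun x => div_nonneg (h0 x) (Real.cosh_pos x).le)
          (hint.integrable_indicator measurableSet_Iic) (.of_forall fun x => ?_)
        by_cases hx : x ≤ a
        · simp only [Set.indicator, Set.mem_Iic, hx, if_true]
          exact (div_le_div_of_nonneg_right (h1 x) (Real.cosh_pos x).le).trans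
            (inv_cosh_le_two_mul_exp x)
        · have : f x = 0 := not_not.mp fun h => hx (hsupp x h)
          simp [hx, this]
    _ = 2 * Real.exp a := by
        rw [integral_indicator measurableSet_Iic, integral_const_mul, integral_exp_Iic]

/-- If at time `t` the front profile satisfies
`H(z₁,t) = z₁ + Φ(z₁,t) ≤ -B - (1-ε)(F - z₁)` for all `z₁ ≤ F`, then the total
contribution of the region `z₁ ≤ F` to the velocity amplitude is at most
`e^{K-B}/(1-ε)`. -/
theorem stmt_14 (K B F ε t : ℝ) (hK : 0 < K) (hε : ε ∈ Set.Ioo (0:ℝ) 1)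
    (ω₀ : ℝ × ℝ → ℝ) (hmeas : Measurable ω₀)
    (hrange : ∀ z, 0 ≤ ω₀ z ∧ ω₀ z ≤ 1)
    (hsupp : ∀ z : ℝ × ℝ, ω₀ z ≠ 0 → z.2 ≤ z.1 + K)
    (Φ : ℝ → ℝ → ℝ) (ht : 0 ≤ t)
    (hH : ∀ z₁ : ℝ, z₁ ≤ F → z₁ + Φ z₁ t ≤ -B - (1 - ε) * (F - z₁)) :
    (1 / 4) * ∫ z₁ in Set.Iio F, ∫ z₂ : ℝ,
        ω₀ (z₁, z₂ - Φ z₁ t) / Real.cosh z₂ ≤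
      Real.exp (K - B) / (1 - ε) := by
  have hc : 0 < 1 - ε := sub_pos.mpr hε.2
  set c := 2 * Real.exp (K - B - (1 - ε) * F) with hcdef
  have hint : IntegrableOn (fun z => c * Real.exp ((1 - ε) * z)) (Set.Iio F) :=
    ((integrableOn_exp_mul_Iic hc F).mono_set Set.Iio_subset_Iic_self).const_mul c
  have hle : ∫ z₁ in Set.Iio F, ∫ z₂ : ℝ, ω₀ (z₁, z₂ - Φ z₁ t) / Real.cosh z₂ ≤
      ∫ z in Set.Iio F, c * Real.exp ((1 - ε) * z) := by
    refine integral_mono_of_nonneg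
      (.of_forall fun z₁ => integral_nonneg fun z₂ =>
        div_nonneg (hrange _).1 (Real.cosh_pos z₂).le) hint ?_
    filter_upwards [ae_restrict_mem measurableSet_Iio] with z₁ hz
    refine (integral_div_cosh_le (fun z₂ => ω₀ (z₁, z₂ - Φ z₁ t)) (z₁ + Φ z₁ t + K)
      (fun _ => (hrange _).1) (fun _ => (hrange _).2) fun z₂ h => ?_).trans ?_
    · have := hsupp _ h
      dsimp only at this
      linarith
    · rw [hcdef, mul_assoc, ← Real.exp_add]
      refine mul_le_mul_of_nonneg_left (Real.exp_le_exp.mpr ?_) zero_le_two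
      linarith [hH z₁ (le_of_lt hz)]
  have heq : ∫ z in Set.Iio F, c * Real.exp ((1 - ε) * z) =
      2 * (Real.exp (K - B) / (1 - ε)) := by
    rw [integral_const_mul, ← integral_Iic_eq_integral_Iio, integral_exp_mul_Iic hc, hcdef,
      mul_assoc, ← mul_div_assoc, ← Real.exp_add]
    congr 3
    ring
  have hpos : 0 < Real.exp (K - B) / (1 - ε) := by positivity
  linarith
end

section
/- Let t₁ ≥ t₀ be any time such that Ω(F₁(t₁),t₁) = A₀, and set δt := 100(B+K)e^{B+K}/A₀ (note δt ≤ 1). Then Ω(F₁(t₁+δt), t₁+δt) ≤ A₀/2, and lim_{z₁→−∞} Ω(z₁,t) ≤ 2A₀ e^{B+K} for all t ∈ [t₁, t₁+δt]. -/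
open MeasureTheory Real

/-- The limit `Ω(-∞,t)`, i.e. the full integral
`(1/4)∫_ℝ ∫_ℝ ω₀(z̃₁, z₂ - Φ(z̃₁,t))/cosh(z₂) dz₂ dz̃₁`. -/
noncomputable def OmegInf (ω₀ : ℝ × ℝ → ℝ) (Φ : ℝ → ℝ → ℝ) (t : ℝ) : ℝ :=
  (1 / 4) * ∫ w : ℝ, ∫ z₂ : ℝ, ω₀ (w, z₂ - Φ w t) / Real.cosh z₂

open Set Filter Topology

/-! ### Elementary bounds -/

theorem exp_le_two_mul_cosh (x : ℝ) : exp x ≤ 2 * cosh x := by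
  rw [cosh_eq]; linarith [exp_pos (-x)]

theorem cosh_le_exp_abs (x : ℝ) : cosh x ≤ exp |x| := by
  rw [← cosh_abs, cosh_eq]
  linarith [exp_le_exp.2 (show -|x| ≤ |x| by linarith [abs_nonneg x])]

theorem integral_exp_mul_sub_le {k a b : ℝ} (hk : 0 < k) :
    ∫ s in a..b, exp (k * (s - b)) ≤ 1 / k := by
  have hd : ∀ x ∈ uIcc a b, HasDerivAt (fun s => exp (k * (s - b)) / k) (exp (k * (x - b))) x := by
    intro x _
    have := (((((hasDerivAt_id x).sub_const b).const_mul k).exp).div_const k)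
    refine this.congr_deriv ?_
    simp only [id, mul_one]
    field_simp
  rw [intervalIntegral.integral_eq_sub_of_hasDerivAt hd
    (Continuous.intervalIntegrable (by fun_prop) _ _)]
  have : 0 ≤ exp (k * (a - b)) / k := by positivity
  simp only [sub_self, mul_zero, exp_zero]
  linarith

/-- The last point at which a continuous function crosses the level `p` upwards. -/
theorem exists_last_eq {h : ℝ → ℝ} {v z p : ℝ} (hc : Continuous h) (hvz : v ≤ z)
    (hv : h v ≤ p) (hz : p ≤ h z) : ∃ a ∈ Icc v z, h a = p ∧ ∀ x ∈ Icc a z, p ≤ h x := by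
  have hne : (Icc v z ∩ h ⁻¹' {p}).Nonempty := by
    obtain ⟨x, hx, hxp⟩ := intermediate_value_Icc hvz hc.continuousOn ⟨hv, hz⟩
    exact ⟨x, hx, hxp⟩
  obtain ⟨a, ⟨ha, hap⟩, hmax⟩ :=
    (isCompact_Icc.inter_right (isClosed_singleton.preimage hc)).exists_isGreatest hne
  refine ⟨a, ha, hap, fun x hx => ?_⟩
  by_contra! hlt
  obtain ⟨y, hy, hyp⟩ := intermediate_value_Icc hx.2 hc.continuousOn ⟨hlt.le, hz⟩
  have hya : y ≤ a := hmax ⟨⟨ha.1.trans (hx.1.trans hy.1), hy.2⟩, hyp⟩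
  have : x = a := le_antisymm (hy.1.trans hya) hx.1
  rw [this] at hlt
  exact absurd hap hlt.ne

/-- The first point at which a continuous function crosses the level `p` upwards. -/
theorem exists_first_eq {h : ℝ → ℝ} {v z p : ℝ} (hc : Continuous h) (hvz : v ≤ z)
    (hv : h v ≤ p) (hz : p ≤ h z) : ∃ b ∈ Icc v z, h b = p ∧ ∀ x ∈ Icc v b, h x ≤ p := by
  obtain ⟨a, ha, hap, hx⟩ := exists_last_eq (h := fun x => -h (-x)) (v := -z) (z := -v) (p := -p)
    (by fun_prop) (by linarith) (by simpa using hz) (by simpa using hv)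
  refine ⟨-a, ⟨by linarith [ha.2], by linarith [ha.1]⟩, by linarith, fun x hxm => ?_⟩
  have := hx (-x) ⟨by linarith [hxm.2], by linarith [hxm.1]⟩
  rw [neg_neg] at this
  linarith

/-! ### The weighted mass of a vertical slice -/

/-- The mass `∫ ω₀(w, z₂) / cosh(z₂ - w + h) dz₂` of the slice over `w` when its centre has been
shifted to height `h`. -/
noncomputable def sliceMass (K : ℝ) (ω₀ : ℝ × ℝ → ℝ) (w h : ℝ) : ℝ :=
  ∫ u in (-K)..K, ω₀ (w, w + u) / cosh (u + h)

/-- Continuous vorticity with values in `[0, 1]`, supported in the wedge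
`|z₁ - z₂| ≤ K`, `z₁ + z₂ ≤ K`. -/
structure IsWedgeVorticity (K : ℝ) (ω₀ : ℝ × ℝ → ℝ) : Prop where
  pos : 0 < K
  cont : Continuous ω₀
  range : ∀ z, 0 ≤ ω₀ z ∧ ω₀ z ≤ 1
  supp : ∀ z : ℝ × ℝ, ω₀ z ≠ 0 → |z.1 - z.2| ≤ K ∧ z.1 + z.2 ≤ K

namespace IsWedgeVorticity

variable {K : ℝ} {ω₀ : ℝ × ℝ → ℝ}

theorem integrand_continuous (hw : IsWedgeVorticity K ω₀) (w h : ℝ) :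
    Continuous fun u => ω₀ (w, w + u) / cosh (u + h) :=
  (hw.cont.comp (by fun_prop)).div (continuous_cosh.comp (by fun_prop))
    fun x => (cosh_pos _).ne'

theorem slice_eq_zero (hw : IsWedgeVorticity K ω₀) {w u : ℝ} (hu : u ∉ Icc (-K) K) :
    ω₀ (w, w + u) = 0 := by
  by_contra hne
  have := (hw.supp _ hne).1
  rw [abs_le] at this
  exact hu ⟨by linarith [this.2], by linarith [this.1]⟩

theorem integral_eq_sliceMass (hw : IsWedgeVorticity K ω₀) (w p : ℝ) :
    ∫ z₂ : ℝ, ω₀ (w, z₂ - p) / cosh z₂ = sliceMass K ω₀ w (w + p) := by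
  rw [← integral_add_right_eq_self _ (w + p), sliceMass,
    intervalIntegral.integral_of_le (by linarith [hw.pos]), ← integral_Icc_eq_integral_Ioc,
    setIntegral_eq_integral_of_forall_compl_eq_zero]
  · refine integral_congr_ae (Eventually.of_forall fun u => ?_)
    simp only
    rw [show u + (w + p) - p = w + u by ring]
  · intro u hu
    rw [hw.slice_eq_zero hu, zero_div]

theorem integral_slice (hw : IsWedgeVorticity K ω₀) (w : ℝ) :
    ∫ z₂ : ℝ, ω₀ (w, z₂) = ∫ u in (-K)..K, ω₀ (w, w + u) := by
  rw [← integral_add_right_eq_self _ w,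
    intervalIntegral.integral_of_le (by linarith [hw.pos]), ← integral_Icc_eq_integral_Ioc,
    setIntegral_eq_integral_of_forall_compl_eq_zero]
  · refine integral_congr_ae (Eventually.of_forall fun u => ?_)
    simp only
    rw [add_comm]
  · intro u hu
    exact hw.slice_eq_zero hu

theorem continuous_sliceMass (hw : IsWedgeVorticity K ω₀) :
    Continuous fun p : ℝ × ℝ => sliceMass K ω₀ p.1 p.2 := by
  refine intervalIntegral.continuous_parametric_intervalIntegral_of_continuous' ?_ _ _
  exact (hw.cont.comp (by fun_prop)).div (continuous_cosh.comp (by fun_prop))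
    fun x => (cosh_pos _).ne'

theorem sliceMass_nonneg (hw : IsWedgeVorticity K ω₀) (w h : ℝ) : 0 ≤ sliceMass K ω₀ w h :=
  intervalIntegral.integral_nonneg (by linarith [hw.pos])
    fun _ _ => div_nonneg (hw.range _).1 (cosh_pos _).le

theorem sliceMass_eq_zero (hw : IsWedgeVorticity K ω₀) {w : ℝ} (hwK : K < w) (h : ℝ) :
    sliceMass K ω₀ w h = 0 := by
  rw [sliceMass, intervalIntegral.integral_congr (g := fun _ => 0), intervalIntegral.integral_zero]
  intro u hu
  have : ω₀ (w, w + u) = 0 := by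
    by_contra hne
    have := (hw.supp _ hne).2
    rw [uIcc_of_le (by linarith [hw.pos])] at hu
    simp only at this
    linarith [hu.1]
  simp [this]

theorem sliceMass_le_two_mul (hw : IsWedgeVorticity K ω₀) (w h : ℝ) :
    sliceMass K ω₀ w h ≤ 2 * K := by
  calc sliceMass K ω₀ w h ≤ ∫ _u in (-K)..K, (1 : ℝ) := by
        refine intervalIntegral.integral_mono_on (by linarith [hw.pos])
          ((hw.integrand_continuous w h).intervalIntegrable _ _)
          (by simp) fun u _ => ?_
        rw [div_le_one (cosh_pos _)]
        exact (hw.range _).2.trans (one_le_cosh _)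
    _ = 2 * K := by simp; ring

theorem sliceMass_le_exp (hw : IsWedgeVorticity K ω₀) (w h : ℝ) :
    sliceMass K ω₀ w h ≤ 2 * exp (h + K) := by
  have hi : ∫ s in (-K)..K, exp (1 * (s - K)) ≤ 1 / 1 := integral_exp_mul_sub_le one_pos
  calc sliceMass K ω₀ w h ≤ ∫ u in (-K)..K, 2 * exp (h + K) * exp (1 * (u - K)) := by
        refine intervalIntegral.integral_mono_on (by linarith [hw.pos])
          ((hw.integrand_continuous w h).intervalIntegrable _ _)
          (Continuous.intervalIntegrable (by fun_prop) _ _) fun u _ => ?_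
        have h1 := exp_le_two_mul_cosh (-(u + h))
        rw [cosh_neg, exp_neg] at h1
        rw [mul_assoc, ← exp_add, show h + K + 1 * (u - K) = u + h by ring,
          div_le_iff₀ (cosh_pos _)]
        have h2 := exp_pos (u + h)
        have h3 : 1 ≤ exp (u + h) * (2 * cosh (u + h)) := by
          calc (1 : ℝ) = exp (u + h) * (exp (u + h))⁻¹ := by field_simp
            _ ≤ _ := by gcongr
        linarith [(hw.range (w, w + u)).2]
    _ = 2 * exp (h + K) * ∫ u in (-K)..K, exp (1 * (u - K)) :=
        intervalIntegral.integral_const_mul _ _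
    _ ≤ 2 * exp (h + K) * 1 := by
        gcongr
        simpa using hi
    _ = 2 * exp (h + K) := mul_one _

theorem sliceMass_le_mul (hw : IsWedgeVorticity K ω₀) {w h h' r : ℝ}
    (hr : ∀ u ∈ Icc (-K) K, cosh (u + h) ≤ r * cosh (u + h')) :
    sliceMass K ω₀ w h' ≤ r * sliceMass K ω₀ w h := by
  rw [sliceMass, sliceMass, ← intervalIntegral.integral_const_mul]
  refine intervalIntegral.integral_mono_on (by linarith [hw.pos])
    ((hw.integrand_continuous w h').intervalIntegrable _ _)
    (((hw.integrand_continuous w h).intervalIntegrable _ _).const_mul r) fun u hu => ?_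
  have h1 := cosh_pos (u + h)
  rw [← mul_div_assoc, div_le_div_iff₀ (cosh_pos _) h1]
  nlinarith [hr u hu, (hw.range (w, w + u)).1]

/-- Moving a slice upwards from height at least `-B` increases its mass by a bounded factor. -/
theorem sliceMass_le_exp_mul (hw : IsWedgeVorticity K ω₀) {w h h' B : ℝ} (hB : 0 ≤ B)
    (hh : -B ≤ h) (hh' : h ≤ h') : sliceMass K ω₀ w h' ≤ exp (B + K) * sliceMass K ω₀ w h := by
  refine hw.sliceMass_le_mul fun u hu => ?_
  have hK := hw.pos
  have he : 1 ≤ exp (B + K) := one_le_exp (by linarith)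
  rcases le_total 0 (u + h) with h0 | h0
  · have : cosh (u + h) ≤ cosh (u + h') := by
      rw [cosh_le_cosh, abs_of_nonneg h0, abs_of_nonneg (by linarith)]; linarith
    nlinarith [cosh_pos (u + h')]
  · have h1 : cosh (u + h) ≤ exp (B + K) :=
      (cosh_le_exp_abs _).trans (exp_le_exp.2 (by rw [abs_of_nonpos h0]; linarith [hu.1]))
    nlinarith [one_le_cosh (u + h')]

/-- Moving a slice far upwards from height at least `-B` makes its mass small. -/
theorem sliceMass_le_div_ten (hw : IsWedgeVorticity K ω₀) {w h h' B : ℝ} (hB : 1 ≤ B)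
    (hh : -B ≤ h) (hh' : h + 50 * (B + K) ≤ h') :
    sliceMass K ω₀ w h' ≤ 1 / 10 * sliceMass K ω₀ w h := by
  refine hw.sliceMass_le_mul fun u hu => ?_
  have hK := hw.pos
  have h1 : |u + h| ≤ u + h' - 48 := by
    rw [abs_le]; constructor <;> linarith [hu.1]
  have h2 := (cosh_le_exp_abs (u + h)).trans (exp_le_exp.2 h1)
  have h3 := exp_le_two_mul_cosh (u + h')
  have h4 : exp (u + h') = exp (u + h' - 48) * exp 48 := by rw [← exp_add]; ring_nf
  have h5 : (49 : ℝ) ≤ exp 48 := by linarith [add_one_le_exp (48 : ℝ)]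
  nlinarith [exp_pos (u + h' - 48)]

theorem le_sliceMass (hw : IsWedgeVorticity K ω₀) {w h : ℝ} (hh : h ∈ Icc (-1) 0) :
    exp (-K - 1) * ∫ z₂ : ℝ, ω₀ (w, z₂) ≤ sliceMass K ω₀ w h := by
  rw [hw.integral_slice, sliceMass, ← intervalIntegral.integral_const_mul]
  have hK := hw.pos
  refine intervalIntegral.integral_mono_on (by linarith)
    (Continuous.intervalIntegrable (continuous_const.mul (hw.cont.comp (by fun_prop))) _ _)
    ((hw.integrand_continuous w h).intervalIntegrable _ _) fun u hu => ?_
  rw [le_div_iff₀ (cosh_pos _)]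
  have h1 : cosh (u + h) ≤ exp (K + 1) := by
    refine (cosh_le_exp_abs _).trans (exp_le_exp.2 ?_)
    rw [abs_le]; constructor <;> linarith [hu.1, hu.2, hh.1, hh.2]
  have h2 : exp (-K - 1) * exp (K + 1) = 1 := by rw [← exp_add]; simp
  have h3 : exp (-K - 1) * cosh (u + h) ≤ 1 :=
    (mul_le_mul_of_nonneg_left h1 (exp_pos _).le).trans_eq h2
  nlinarith [(hw.range (w, w + u)).1]

end IsWedgeVorticity

/-! ### The flow of the slices -/

/-- A quarter of the total mass of the slices to the right of `z`, at time `t`, where the slice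
over `w` has its centre at height `H w t`. -/
noncomputable def amplitude (K : ℝ) (ω₀ : ℝ × ℝ → ℝ) (H : ℝ → ℝ → ℝ) (z t : ℝ) : ℝ :=
  (1 / 4) * ∫ w in z..max z K, sliceMass K ω₀ w (H w t)

/-- The slices of a wedge vorticity move upwards from the diagonal, with twice the amplitude as
their speed. -/
structure IsSliceFlow (K : ℝ) (ω₀ : ℝ × ℝ → ℝ) (H : ℝ → ℝ → ℝ) : Prop
    extends IsWedgeVorticity K ω₀ where
  contH : Continuous fun p : ℝ × ℝ => H p.1 p.2
  eq : ∀ z t : ℝ, 0 ≤ t → H z t = z + 2 * ∫ s in (0 : ℝ)..t, amplitude K ω₀ H z s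
  bounded : ∀ t : ℝ, 0 ≤ t → ∃ M, ∀ z, H z t ≤ z + M

namespace IsSliceFlow

variable {K : ℝ} {ω₀ : ℝ × ℝ → ℝ} {H : ℝ → ℝ → ℝ}

theorem continuous_height (hH : IsSliceFlow K ω₀ H) (t : ℝ) : Continuous fun w => H w t :=
  hH.contH.comp (by fun_prop : Continuous fun w : ℝ => (w, t))

theorem continuous_mass (hH : IsSliceFlow K ω₀ H) :
    Continuous fun p : ℝ × ℝ => sliceMass K ω₀ p.1 (H p.1 p.2) :=
  hH.continuous_sliceMass.comp (continuous_fst.prodMk hH.contH)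

theorem continuous_mass_left (hH : IsSliceFlow K ω₀ H) (t : ℝ) :
    Continuous fun w => sliceMass K ω₀ w (H w t) :=
  hH.continuous_mass.comp (by fun_prop : Continuous fun w : ℝ => (w, t))

theorem mass_intervalIntegrable (hH : IsSliceFlow K ω₀ H) (t a b : ℝ) :
    IntervalIntegrable (fun w => sliceMass K ω₀ w (H w t)) volume a b :=
  (hH.continuous_mass_left t).intervalIntegrable _ _

theorem integral_mass_eq_zero (hH : IsSliceFlow K ω₀ H) {a b : ℝ} (ha : K ≤ a) (hb : K ≤ b)
    (t : ℝ) : ∫ w in a..b, sliceMass K ω₀ w (H w t) = 0 := by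
  refine intervalIntegral.integral_zero_ae (Eventually.of_forall fun w hw => ?_)
  exact hH.sliceMass_eq_zero ((le_min ha hb).trans_lt hw.1) _

theorem amplitude_eq (hH : IsSliceFlow K ω₀ H) {M : ℝ} (hM : K ≤ M) (z t : ℝ) :
    amplitude K ω₀ H z t = (1 / 4) * ∫ w in z..M, sliceMass K ω₀ w (H w t) := by
  rw [amplitude, ← intervalIntegral.integral_add_adjacent_intervals
    (hH.mass_intervalIntegrable t z (max z K)) (hH.mass_intervalIntegrable t (max z K) M),
    hH.integral_mass_eq_zero (le_max_right _ _) hM, add_zero]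

theorem amplitude_eq_add (hH : IsSliceFlow K ω₀ H) (a b t : ℝ) :
    amplitude K ω₀ H a t =
      amplitude K ω₀ H b t + (1 / 4) * ∫ w in a..b, sliceMass K ω₀ w (H w t) := by
  rw [hH.amplitude_eq le_rfl, hH.amplitude_eq le_rfl, ← intervalIntegral.integral_add_adjacent_intervals
      (hH.mass_intervalIntegrable t a b) (hH.mass_intervalIntegrable t b _)]
  ring

theorem integral_mass_nonneg (hH : IsSliceFlow K ω₀ H) {a b : ℝ} (hab : a ≤ b) (t : ℝ) :
    0 ≤ ∫ w in a..b, sliceMass K ω₀ w (H w t) :=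
  intervalIntegral.integral_nonneg hab fun _ _ => hH.sliceMass_nonneg _ _

theorem amplitude_nonneg (hH : IsSliceFlow K ω₀ H) (z t : ℝ) : 0 ≤ amplitude K ω₀ H z t :=
  mul_nonneg (by norm_num) (hH.integral_mass_nonneg (le_max_left _ _) t)

theorem amplitude_antitone (hH : IsSliceFlow K ω₀ H) {a b : ℝ} (hab : a ≤ b) (t : ℝ) :
    amplitude K ω₀ H b t ≤ amplitude K ω₀ H a t := by
  rw [hH.amplitude_eq_add a b]
  linarith [hH.integral_mass_nonneg hab t]

theorem amplitude_eq_zero (hH : IsSliceFlow K ω₀ H) {z : ℝ} (hz : K ≤ z) (t : ℝ) :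
    amplitude K ω₀ H z t = 0 := by
  rw [hH.amplitude_eq hz]; simp

theorem continuous_integral_mass (hH : IsSliceFlow K ω₀ H) (a b : ℝ) :
    Continuous fun t => ∫ w in a..b, sliceMass K ω₀ w (H w t) := by
  refine intervalIntegral.continuous_parametric_intervalIntegral_of_continuous' ?_ a b
  exact hH.continuous_mass.comp continuous_swap

theorem continuous_amplitude (hH : IsSliceFlow K ω₀ H) (z : ℝ) :
    Continuous fun t => amplitude K ω₀ H z t :=
  continuous_const.mul (hH.continuous_integral_mass _ _)

theorem continuous_amplitude_left (hH : IsSliceFlow K ω₀ H) (t : ℝ) :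
    Continuous fun z => amplitude K ω₀ H z t := by
  have h : (fun z => amplitude K ω₀ H z t) = fun z => amplitude K ω₀ H 0 t
      - (1 / 4) * ∫ w in (0 : ℝ)..z, sliceMass K ω₀ w (H w t) := by
    funext z
    rw [hH.amplitude_eq_add 0 z]; ring
  rw [h]
  exact continuous_const.sub (continuous_const.mul
    (intervalIntegral.continuous_primitive (hH.mass_intervalIntegrable t) 0))

theorem amplitude_intervalIntegrable (hH : IsSliceFlow K ω₀ H) (z a b : ℝ) :
    IntervalIntegrable (fun t => amplitude K ω₀ H z t) volume a b :=
  (hH.continuous_amplitude z).intervalIntegrable _ _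

theorem eq_add (hH : IsSliceFlow K ω₀ H) (z : ℝ) {s t : ℝ} (hs : 0 ≤ s) (hst : s ≤ t) :
    H z t = H z s + 2 * ∫ τ in s..t, amplitude K ω₀ H z τ := by
  rw [hH.eq z t (hs.trans hst), hH.eq z s hs, ← intervalIntegral.integral_add_adjacent_intervals
    (hH.amplitude_intervalIntegrable z 0 s) (hH.amplitude_intervalIntegrable z s t)]
  ring

theorem add_le_of_le_amplitude (hH : IsSliceFlow K ω₀ H) {z s t m : ℝ} (hs : 0 ≤ s) (hst : s ≤ t)
    (hm : ∀ τ ∈ Icc s t, m ≤ amplitude K ω₀ H z τ) : H z s + 2 * m * (t - s) ≤ H z t := by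
  rw [hH.eq_add z hs hst]
  have : ∫ _τ in s..t, m ≤ ∫ τ in s..t, amplitude K ω₀ H z τ :=
    intervalIntegral.integral_mono_on hst (by simp) (hH.amplitude_intervalIntegrable z s t) hm
  rw [intervalIntegral.integral_const, smul_eq_mul] at this
  linarith

theorem le_add_of_amplitude_le (hH : IsSliceFlow K ω₀ H) {z s t m : ℝ} (hs : 0 ≤ s) (hst : s ≤ t)
    (hm : ∀ τ ∈ Icc s t, amplitude K ω₀ H z τ ≤ m) : H z t ≤ H z s + 2 * m * (t - s) := by
  rw [hH.eq_add z hs hst]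
  have : ∫ τ in s..t, amplitude K ω₀ H z τ ≤ ∫ _τ in s..t, m :=
    intervalIntegral.integral_mono_on hst (hH.amplitude_intervalIntegrable z s t) (by simp) hm
  rw [intervalIntegral.integral_const, smul_eq_mul] at this
  linarith

theorem height_mono (hH : IsSliceFlow K ω₀ H) (z : ℝ) {s t : ℝ} (hs : 0 ≤ s) (hst : s ≤ t) :
    H z s ≤ H z t := by
  simpa using hH.add_le_of_le_amplitude hs hst fun τ _ => hH.amplitude_nonneg z τ

theorem height_sub (hH : IsSliceFlow K ω₀ H) (a b : ℝ) {t : ℝ} (ht : 0 ≤ t) :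
    H b t - H a t = b - a -
      (1 / 2) * ∫ s in (0 : ℝ)..t, ∫ w in a..b, sliceMass K ω₀ w (H w s) := by
  rw [hH.eq b t ht, hH.eq a t ht, intervalIntegral.integral_congr (fun s _ =>
    hH.amplitude_eq_add a b s), intervalIntegral.integral_add
    (hH.amplitude_intervalIntegrable b 0 t), intervalIntegral.integral_const_mul]
  · ring
  · exact (continuous_const.mul (hH.continuous_integral_mass a b)).intervalIntegrable _ _

theorem height_sub_le (hH : IsSliceFlow K ω₀ H) {a b t : ℝ} (hab : a ≤ b) (ht : 0 ≤ t) :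
    H b t - H a t ≤ b - a := by
  rw [hH.height_sub a b ht]
  have := intervalIntegral.integral_nonneg (μ := volume) ht fun s _ =>
    hH.integral_mass_nonneg hab s
  linarith

/-- Slices which have stayed below height `-B`, and which from time `t₀` on have risen with speed
at least `2 * γ`, keep almost their initial spacing. -/
theorem le_height_sub (hH : IsSliceFlow K ω₀ H) {a b t t₀ γ B : ℝ} (hab : a ≤ b) (ht₀ : 0 ≤ t₀)
    (ht : t₀ ≤ t) (hγ : 0 < γ) (hε : (γ⁻¹ + 2 * t₀) * exp (K - B) ≤ 0.1)
    (hlow : ∀ w ∈ Icc a b, H w t ≤ -B)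
    (hspeed : ∀ w ∈ Icc a b, ∀ s ∈ Icc t₀ t, H w s + 2 * γ * (t - s) ≤ H w t) :
    0.9 * (b - a) ≤ H b t - H a t := by
  have hcont := hH.continuous_integral_mass a b
  have hslice : ∀ s C, (∀ w ∈ Icc a b, H w s ≤ -B + C) →
      ∫ w in a..b, sliceMass K ω₀ w (H w s) ≤ (b - a) * (2 * exp (K - B)) * exp C := by
    intro s C hC
    calc ∫ w in a..b, sliceMass K ω₀ w (H w s) ≤ ∫ _w in a..b, 2 * exp (K - B + C) := by
          refine intervalIntegral.integral_mono_on hab (hH.mass_intervalIntegrable s a b)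
            (by simp) fun w hw => (hH.sliceMass_le_exp _ _).trans ?_
          exact mul_le_mul_of_nonneg_left (exp_le_exp.2 (by linarith [hC w hw])) zero_le_two
      _ = _ := by
          rw [intervalIntegral.integral_const, exp_add, smul_eq_mul]; ring
  have h1 : ∫ s in (0 : ℝ)..t₀, ∫ w in a..b, sliceMass K ω₀ w (H w s) ≤
      t₀ * ((b - a) * (2 * exp (K - B))) := by
    calc _ ≤ ∫ _s in (0 : ℝ)..t₀, (b - a) * (2 * exp (K - B)) := by
          refine intervalIntegral.integral_mono_on ht₀ (hcont.intervalIntegrable _ _)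
            (by simp) fun s hs => ?_
          have := hslice s 0 fun w hw => by
            linarith [hlow w hw, hH.height_mono w hs.1 (hs.2.trans ht)]
          simpa using this
      _ = _ := by rw [intervalIntegral.integral_const, smul_eq_mul, sub_zero]
  have h2 : ∫ s in t₀..t, ∫ w in a..b, sliceMass K ω₀ w (H w s) ≤
      (b - a) * (2 * exp (K - B)) * (1 / (2 * γ)) := by
    calc _ ≤ ∫ s in t₀..t, (b - a) * (2 * exp (K - B)) * exp (2 * γ * (s - t)) := by
          refine intervalIntegral.integral_mono_on ht (hcont.intervalIntegrable _ _)
            (Continuous.intervalIntegrable (by fun_prop) _ _) fun s hs => ?_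
          exact hslice s _ fun w hw => by linarith [hlow w hw, hspeed w hw s hs]
      _ = (b - a) * (2 * exp (K - B)) * ∫ s in t₀..t, exp (2 * γ * (s - t)) :=
          intervalIntegral.integral_const_mul _ _
      _ ≤ _ := by
          have : 0 ≤ (b - a) * (2 * exp (K - B)) :=
            mul_nonneg (by linarith) (by positivity)
          gcongr
          exact integral_exp_mul_sub_le (by linarith)
  rw [hH.height_sub a b (ht₀.trans ht), ← intervalIntegral.integral_add_adjacent_intervals
    (hcont.intervalIntegrable 0 t₀) (hcont.intervalIntegrable t₀ t)]
  have h3 : (b - a) * (2 * exp (K - B)) * (1 / (2 * γ)) = (b - a) * (γ⁻¹ * exp (K - B)) := by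
    field_simp
  have h4 := mul_le_mul_of_nonneg_left hε (sub_nonneg.2 hab)
  nlinarith

/-- To the left of a marker which has reached height `0`, slices below height `-1` move with speed
at least `2 * γ`. -/
theorem le_amplitude (hH : IsSliceFlow K ω₀ H) {c Z₁ v t : ℝ} (hc : 0 ≤ c)
    (hlow : ∀ w : ℝ, w ≤ Z₁ → c ≤ ∫ z₂ : ℝ, ω₀ (w, z₂)) (ht : 0 ≤ t) (hv : v ≤ Z₁)
    (hZ₁ : 0 ≤ H Z₁ t) (hvt : H v t ≤ -1) :
    (c / 4) * exp (-K - 1) ≤ amplitude K ω₀ H v t := by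
  obtain ⟨b, hb, hb0, hbx⟩ := exists_first_eq (hH.continuous_height t) hv (by linarith) hZ₁
  obtain ⟨a, ha, ha1, hax⟩ := exists_last_eq (p := -1) (hH.continuous_height t) hb.1 hvt
    (by linarith)
  have hab : 1 ≤ b - a := by
    have := hH.height_sub_le ha.2 ht
    linarith
  have hint : ∫ _w in a..b, c * exp (-K - 1) ≤ ∫ w in a..b, sliceMass K ω₀ w (H w t) := by
    refine intervalIntegral.integral_mono_on ha.2 (by simp) (hH.mass_intervalIntegrable t a b)
      fun w hw => ?_
    refine le_trans ?_ (hH.le_sliceMass ⟨hax w hw, hbx w ⟨ha.1.trans hw.1, hw.2⟩⟩)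
    rw [mul_comm]
    exact mul_le_mul_of_nonneg_left (hlow w (hw.2.trans hb.2)) (exp_pos _).le
  rw [intervalIntegral.integral_const, smul_eq_mul] at hint
  have h1 : c * exp (-K - 1) ≤ (b - a) * (c * exp (-K - 1)) :=
    le_mul_of_one_le_left (by positivity) hab
  have h2 := hH.amplitude_antitone ha.1 t
  have h3 := hH.amplitude_nonneg b t
  rw [hH.amplitude_eq_add a b] at h2
  linarith

theorem exists_height_le (hH : IsSliceFlow K ω₀ H) {t : ℝ} (ht : 0 ≤ t) (w p : ℝ) :
    ∃ v ≤ w, H v t ≤ p := by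
  obtain ⟨M, hM⟩ := hH.bounded t ht
  exact ⟨min w (p - M), min_le_left _ _, by linarith [hM (min w (p - M)), min_le_right w (p - M)]⟩

/-- If slices up to the first crossing of height `-B` and beyond keep a positive spacing whenever
they are below `-B`, then no slice to the right of the crossing is below `-B`. -/
theorem neg_le_height_of_spacing (hH : IsSliceFlow K ω₀ H) {p q t B : ℝ} (hpq : p ≤ q)
    (hp : -B ≤ H p t)
    (hspace : ∀ a b, p ≤ a → a ≤ b → b ≤ q → (∀ w ∈ Icc a b, H w t ≤ -B) →
      0.9 * (b - a) ≤ H b t - H a t) : -B ≤ H q t := by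
  by_contra! hlt
  obtain ⟨a, ha, haB, hax⟩ := exists_last_eq (h := fun w => -H w t) (p := B)
    (hH.continuous_height t).neg hpq (by linarith) (by linarith)
  have := hspace a q ha.1 ha.2 le_rfl fun w hw => by linarith [hax w hw]
  linarith [ha.2]

end IsSliceFlow

/-- The part of the flow below height `-B` from time `t₀` on is the half-line to the left of the
front `F`, and is almost undistorted. -/
structure IsFront (K : ℝ) (ω₀ : ℝ × ℝ → ℝ) (H : ℝ → ℝ → ℝ) (B t₀ : ℝ) (F : ℝ → ℝ) : Prop
    extends IsSliceFlow K ω₀ H where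
  one_le : 1 ≤ B
  le_B : K ≤ B
  start_nonneg : 0 ≤ t₀
  isLeast : ∀ t, t₀ ≤ t → IsLeast {w | H w t = -B} (F t)
  height_le : ∀ t, t₀ ≤ t → ∀ w ≤ F t, H w t ≤ -B
  le_height : ∀ t, t₀ ≤ t → ∀ w, F t ≤ w → -B ≤ H w t
  spacing : ∀ t, t₀ ≤ t → ∀ a b, a ≤ b → b ≤ F t → 0.9 * (b - a) ≤ H b t - H a t

theorem IsSliceFlow.isFront {K : ℝ} {ω₀ : ℝ × ℝ → ℝ} {H : ℝ → ℝ → ℝ}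
    (hH : IsSliceFlow K ω₀ H) {c Z₁ B t₀ : ℝ} {F : ℝ → ℝ} (hc : 0 < c)
    (hlow : ∀ w : ℝ, w ≤ Z₁ → c ≤ ∫ z₂ : ℝ, ω₀ (w, z₂)) (hB : max K 1 ≤ B) (ht₀ : 0 ≤ t₀)
    (hε : (((c / 4) * exp (-K - 1))⁻¹ + 2 * t₀) * exp (K - B) ≤ 0.1)
    (hF : ∀ t, t₀ ≤ t → IsLeast {w | H w t = -B} (F t))
    (hZ₁ : ∀ t, t₀ ≤ t → 0 ≤ H Z₁ t) : IsFront K ω₀ H B t₀ F := by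
  have hB1 : 1 ≤ B := (le_max_right _ _).trans hB
  have hγ : 0 < (c / 4) * exp (-K - 1) := by positivity
  have hheight_le : ∀ t, t₀ ≤ t → ∀ w ≤ F t, H w t ≤ -B := by
    intro t ht w hw
    by_contra! hlt
    obtain ⟨v, hv, hvB⟩ := hH.exists_height_le (ht₀.trans ht) w (-B)
    obtain ⟨x, hx, hxB⟩ :=
      intermediate_value_Icc hv (hH.continuous_height t).continuousOn ⟨hvB, hlt.le⟩
    have hxF : F t ≤ x := (hF t ht).2 hxB
    have : x = w := le_antisymm hx.2 (hw.trans hxF)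
    rw [this] at hxB
    exact hlt.ne' hxB
  have hspacing : ∀ t, t₀ ≤ t → ∀ a b, a ≤ b → b ≤ Z₁ → (∀ w ∈ Icc a b, H w t ≤ -B) →
      0.9 * (b - a) ≤ H b t - H a t := by
    intro t ht a b hab hb hlowB
    refine hH.le_height_sub hab ht₀ ht hγ hε hlowB fun w hw s hs => ?_
    refine hH.add_le_of_le_amplitude (ht₀.trans hs.1) hs.2 fun τ hτ => ?_
    have hτ₀ : t₀ ≤ τ := hs.1.trans hτ.1
    refine hH.le_amplitude hc.le hlow (ht₀.trans hτ₀) (hw.2.trans hb) (hZ₁ τ hτ₀) ?_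
    linarith [hH.height_mono w (ht₀.trans hτ₀) hτ.2, hlowB w hw]
  have hFZ : ∀ t, t₀ ≤ t → F t ≤ Z₁ := by
    intro t ht
    by_contra! hlt
    linarith [hheight_le t ht Z₁ hlt.le, hZ₁ t ht]
  have hright : ∀ w, Z₁ ≤ w → -B ≤ H w t₀ := by
    intro w hw
    refine hH.neg_le_height_of_spacing hw (by linarith [hZ₁ t₀ le_rfl])
      fun a b _ hab _ hlowB => hH.le_height_sub hab ht₀ le_rfl hγ hε hlowB fun v _ s hs => ?_
    rw [le_antisymm hs.2 hs.1]
    simp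
  refine ⟨hH, hB1, (le_max_left _ _).trans hB, ht₀, hF, hheight_le, fun t ht w hw => ?_,
    fun t ht a b hab hb => hspacing t ht a b hab (hb.trans (hFZ t ht))
      fun w hw => hheight_le t ht w (hw.2.trans hb)⟩
  rcases le_total w Z₁ with hwZ | hwZ
  · exact hH.neg_le_height_of_spacing hw (hF t ht).1.ge
      fun a b _ hab hb => hspacing t ht a b hab (hb.trans hwZ)
  · exact (hright w hwZ).trans (hH.height_mono w ht₀ ht)

namespace IsFront

variable {K B t₀ : ℝ} {ω₀ : ℝ × ℝ → ℝ} {H : ℝ → ℝ → ℝ} {F : ℝ → ℝ}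

theorem height_eq (hf : IsFront K ω₀ H B t₀ F) {t : ℝ} (ht : t₀ ≤ t) : H (F t) t = -B :=
  (hf.isLeast t ht).1

theorem front_antitone (hf : IsFront K ω₀ H B t₀ F) {s t : ℝ} (hs : t₀ ≤ s) (hst : s ≤ t) :
    F t ≤ F s := by
  by_contra! hlt
  have h1 := hf.height_le t (hs.trans hst) (F s) hlt.le
  have h2 := hf.height_mono (F s) (hf.start_nonneg.trans hs) hst
  rw [hf.height_eq hs] at h2
  exact hlt.not_ge ((hf.isLeast t (hs.trans hst)).2 (le_antisymm h1 h2))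

theorem front_sub_le (hf : IsFront K ω₀ H B t₀ F) {s t m : ℝ} (hs : t₀ ≤ s) (hst : s ≤ t)
    (hm : ∀ τ ∈ Icc s t, amplitude K ω₀ H (F t) τ ≤ m) :
    0.9 * (F s - F t) ≤ 2 * m * (t - s) := by
  have h1 := hf.spacing s hs (F t) (F s) (hf.front_antitone hs hst) le_rfl
  have h2 := hf.le_add_of_amplitude_le (hf.start_nonneg.trans hs) hst hm
  rw [hf.height_eq hs] at h1
  rw [hf.height_eq (hs.trans hst)] at h2
  linarith

/-- The mass below the front is bounded. -/
theorem integral_mass_le (hf : IsFront K ω₀ H B t₀ F) {z t : ℝ} (ht : t₀ ≤ t) (hz : z ≤ F t) :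
    ∫ w in z..F t, sliceMass K ω₀ w (H w t) ≤ 3 := by
  calc _ ≤ ∫ w in z..F t, 2 * exp (0.9 * (w - F t)) := by
        refine intervalIntegral.integral_mono_on hz (hf.mass_intervalIntegrable _ _ _)
          (Continuous.intervalIntegrable (by fun_prop) _ _) fun w hw => ?_
        refine (hf.sliceMass_le_exp _ _).trans
          (mul_le_mul_of_nonneg_left (exp_le_exp.2 ?_) zero_le_two)
        have := hf.spacing t ht w (F t) hw.2 le_rfl
        rw [hf.height_eq ht] at this
        linarith [hf.le_B]
    _ = 2 * ∫ w in z..F t, exp (0.9 * (w - F t)) := intervalIntegral.integral_const_mul _ _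
    _ ≤ 2 * (1 / 0.9) := by
        gcongr
        exact integral_exp_mul_sub_le (by norm_num)
    _ ≤ 3 := by norm_num

theorem amplitude_le_exp_mul (hf : IsFront K ω₀ H B t₀ F) {a s t : ℝ} (hs : t₀ ≤ s) (hst : s ≤ t)
    (ha : F s ≤ a) :
    amplitude K ω₀ H a t ≤ exp (B + K) * amplitude K ω₀ H a s := by
  rw [amplitude, amplitude, mul_left_comm, ← intervalIntegral.integral_const_mul (exp (B + K))]
  refine mul_le_mul_of_nonneg_left ?_ (by norm_num : (0 : ℝ) ≤ 1 / 4)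
  refine intervalIntegral.integral_mono_on (le_max_left _ _) (hf.mass_intervalIntegrable _ _ _)
    ((hf.mass_intervalIntegrable _ _ _).const_mul _) fun w hw => ?_
  exact hf.sliceMass_le_exp_mul (by linarith [hf.one_le]) (hf.le_height s hs w (ha.trans hw.1))
    (hf.height_mono w (hf.start_nonneg.trans hs) hst)

theorem integral_mass_le_mul (hf : IsFront K ω₀ H B t₀ F) {a b : ℝ} (hab : a ≤ b) (t : ℝ) :
    ∫ w in a..b, sliceMass K ω₀ w (H w t) ≤ 2 * K * (b - a) := by
  have := intervalIntegral.integral_mono_on hab (hf.mass_intervalIntegrable t a b)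
    (g := fun _ => 2 * K) (by simp) fun w _ => hf.sliceMass_le_two_mul w (H w t)
  rw [intervalIntegral.integral_const, smul_eq_mul] at this
  linarith

/-- Over a short time, the amplitude anywhere is controlled by the amplitude at the front at the
initial time. -/
theorem amplitude_le (hf : IsFront K ω₀ H B t₀ F) {t₁ δ A : ℝ} (ht₁ : t₀ ≤ t₁) (hδ : 0 ≤ δ)
    (hKδ : K * δ ≤ 1 / 100) (hA : amplitude K ω₀ H (F t₁) t₁ = A) (hA1 : 1 ≤ A)
    {z t : ℝ} (ht : t ∈ Icc t₁ (t₁ + δ)) :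
    amplitude K ω₀ H z t ≤ 2 * A * exp (B + K) := by
  have hK := hf.pos
  have hle : t₁ ≤ t₁ + δ := by linarith
  set y := min z (F (t₁ + δ)) with hy
  obtain ⟨τ, hτ, hmax⟩ := (isCompact_Icc (a := t₁) (b := t₁ + δ)).exists_isMaxOn
    (nonempty_Icc.2 hle) (hf.continuous_amplitude y).continuousOn
  set m := amplitude K ω₀ H y τ with hm
  have hτ₀ : t₀ ≤ τ := ht₁.trans hτ.1
  have hyτ : y ≤ F τ := (min_le_right _ _).trans (hf.front_antitone hτ₀ hτ.2)
  have hFτ : F τ ≤ F t₁ := hf.front_antitone ht₁ hτ.1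
  have hdisp : 0.9 * (F t₁ - F τ) ≤ 2 * m * (τ - t₁) :=
    hf.front_sub_le ht₁ hτ.1 fun s hs => (hf.amplitude_antitone hyτ s).trans
      (hmax ⟨hs.1, hs.2.trans hτ.2⟩)
  have hm0 : 0 ≤ m := hf.amplitude_nonneg _ _
  have hdisp' : 0.9 * (F t₁ - F τ) ≤ 2 * m * δ :=
    hdisp.trans (mul_le_mul_of_nonneg_left (by linarith [hτ.2]) (by positivity))
  have h1 := hf.integral_mass_le hτ₀ hyτ
  have h2 := hf.integral_mass_le_mul hFτ τ
  have h3 := hf.amplitude_le_exp_mul ht₁ hτ.1 le_rfl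
  have h4 := hf.amplitude_eq_add y (F τ) τ
  have h5 := hf.amplitude_eq_add (F τ) (F t₁) τ
  rw [hA] at h3
  have h6 : K * (0.9 * (F t₁ - F τ)) ≤ m * (1 / 50) := by
    calc K * (0.9 * (F t₁ - F τ)) ≤ K * (2 * m * δ) := by gcongr
      _ = m * 2 * (K * δ) := by ring
      _ ≤ m * 2 * (1 / 100) := by gcongr
      _ = _ := by ring
  have h7 : 1 ≤ exp (B + K) := one_le_exp (by linarith [hf.one_le])
  have h8 : 1 ≤ exp (B + K) * A := one_le_mul_of_one_le_of_one_le h7 hA1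
  have h9 : amplitude K ω₀ H z t ≤ m :=
    (hf.amplitude_antitone (min_le_left _ _) t).trans (hmax ht)
  linarith

/-- After a time in which a slice starting at the front with a fixed fraction of the amplitude
crosses a long distance, the amplitude to the right of the initial front has halved. -/
theorem amplitude_le_mul (hf : IsFront K ω₀ H B t₀ F) {t₁ δ A : ℝ} (ht₁ : t₀ ≤ t₁) (hδ : 0 ≤ δ)
    (hδA : δ * A = 100 * (B + K) * exp (B + K)) (hA : amplitude K ω₀ H (F t₁) t₁ = A) :
    amplitude K ω₀ H (F t₁) (t₁ + δ) ≤ 0.35 * A := by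
  have hle : t₁ ≤ t₁ + δ := by linarith
  have hA0 : 0 ≤ A := hA ▸ hf.amplitude_nonneg _ _
  rcases le_total (amplitude K ω₀ H (F t₁) (t₁ + δ)) (A / 4) with h | h
  · linarith
  have hend : amplitude K ω₀ H (max (F t₁) K) (t₁ + δ) = 0 :=
    hf.amplitude_eq_zero (le_max_right _ _) _
  obtain ⟨a, ha, haA⟩ := intermediate_value_Icc' (le_max_left (F t₁) K)
    (hf.continuous_amplitude_left (t₁ + δ)).continuousOn ⟨by rw [hend]; positivity, h⟩
  have hrise : ∀ w ∈ Icc (F t₁) a, H w t₁ + 50 * (B + K) ≤ H w (t₁ + δ) := by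
    intro w hw
    have hspeed : ∀ τ ∈ Icc t₁ (t₁ + δ),
        A / 4 * exp (-(B + K)) ≤ amplitude K ω₀ H w τ := by
      intro τ hτ
      have h1 := hf.amplitude_le_exp_mul (ht₁.trans hτ.1) hτ.2
        ((hf.front_antitone ht₁ hτ.1).trans hw.1)
      have h2 := hf.amplitude_antitone hw.2 (t₁ + δ)
      simp only at haA
      rw [exp_neg, ← div_eq_mul_inv, div_le_iff₀ (exp_pos _)]
      linarith
    have h3 := hf.add_le_of_le_amplitude (hf.start_nonneg.trans ht₁) hle hspeed
    have h4 : 2 * (A / 4 * exp (-(B + K))) * (t₁ + δ - t₁) = 50 * (B + K) := by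
      calc _ = δ * A * exp (-(B + K)) / 2 := by ring
        _ = 50 * (B + K) * (exp (B + K) * exp (-(B + K))) := by rw [hδA]; ring
        _ = _ := by rw [← exp_add]; simp
    linarith
  have hsmall : ∫ w in F t₁..a, sliceMass K ω₀ w (H w (t₁ + δ)) ≤
      1 / 10 * ∫ w in F t₁..a, sliceMass K ω₀ w (H w t₁) := by
    rw [← intervalIntegral.integral_const_mul]
    exact intervalIntegral.integral_mono_on ha.1 (hf.mass_intervalIntegrable _ _ _)
      ((hf.mass_intervalIntegrable _ _ _).const_mul _) fun w hw =>
      hf.sliceMass_le_div_ten hf.one_le (hf.le_height t₁ ht₁ w hw.1) (hrise w hw)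
  have h5 := hf.amplitude_eq_add (F t₁) a t₁
  have h6 := hf.amplitude_eq_add (F t₁) a (t₁ + δ)
  have h7 := hf.amplitude_nonneg a t₁
  simp only at haA
  linarith

theorem amplitude_front_le (hf : IsFront K ω₀ H B t₀ F) {t₁ δ A : ℝ} (ht₁ : t₀ ≤ t₁) (hδ : 0 ≤ δ)
    (hKδ : K * δ ≤ 1 / 100) (hAeq : A = 10000 * (B + K) ^ 2 * exp (B + K) ^ 2)
    (hδA : δ * A = 100 * (B + K) * exp (B + K)) (hA : amplitude K ω₀ H (F t₁) t₁ = A)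
    (hA1 : 1 ≤ A) : amplitude K ω₀ H (F (t₁ + δ)) (t₁ + δ) ≤ A / 2 := by
  have hle : t₁ ≤ t₁ + δ := by linarith
  have hK := hf.pos
  have hF := hf.front_antitone ht₁ hle
  have h1 := hf.amplitude_le_mul ht₁ hδ hδA hA
  have h2 := hf.front_sub_le ht₁ hle fun τ hτ => hf.amplitude_le ht₁ hδ hKδ hA hA1 hτ
  have h3 := hf.integral_mass_le_mul hF (t₁ + δ)
  have h4 := hf.amplitude_eq_add (F (t₁ + δ)) (F t₁) (t₁ + δ)
  have h5 : 2 * (2 * A * exp (B + K)) * (t₁ + δ - t₁) = 400 * (B + K) * exp (B + K) ^ 2 := by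
    calc _ = 4 * (δ * A) * exp (B + K) := by ring
      _ = _ := by rw [hδA]; ring
  rw [h5] at h2
  have h6 : 2 * K * (F t₁ - F (t₁ + δ)) ≤ (B + K) * (F t₁ - F (t₁ + δ)) :=
    mul_le_mul_of_nonneg_right (by linarith [hf.le_B]) (by linarith)
  have h7 := mul_le_mul_of_nonneg_left h2 (by linarith [hf.one_le] : 0 ≤ B + K)
  nlinarith

end IsFront

/-! ### Global solutions as slice flows -/

theorem OmegInf_le {ω₀ : ℝ × ℝ → ℝ} {Φ : ℝ → ℝ → ℝ} {t C : ℝ} (hC0 : 0 ≤ C)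
    (hC : ∀ z, Omeg ω₀ Φ z t ≤ C) : OmegInf ω₀ Φ t ≤ C := by
  by_cases hi : Integrable fun w : ℝ => ∫ z₂ : ℝ, ω₀ (w, z₂ - Φ w t) / cosh z₂
  · have hcover := aecover_Ioi (μ := volume) (tendsto_id (α := ℝ) (x := atBot))
    have hlim := hcover.integral_tendsto_of_countably_generated hi
    exact le_of_tendsto (hlim.const_mul (1 / 4)) (Eventually.of_forall hC)
  · rw [OmegInf, integral_undef hi, mul_zero]
    exact hC0

theorem IsWedgeVorticity.Omeg_eq_amplitude {K : ℝ} {ω₀ : ℝ × ℝ → ℝ} (hw : IsWedgeVorticity K ω₀)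
    {Φ : ℝ → ℝ → ℝ} {t : ℝ} (ht : 0 ≤ t) (z : ℝ) :
    Omeg ω₀ Φ z t = amplitude K ω₀ (fun w s => w + Φ w (max s 0)) z t := by
  simp only [Omeg, amplitude, hw.integral_eq_sliceMass, max_eq_left ht]
  rw [intervalIntegral.integral_of_le (le_max_left _ _),
    setIntegral_eq_of_subset_of_forall_sdiff_eq_zero measurableSet_Ioi Ioc_subset_Ioi_self]
  rintro w ⟨hzw, hwn⟩
  refine hw.sliceMass_eq_zero ?_ _
  by_contra! hle
  exact hwn ⟨hzw, hle.trans (le_max_right _ _)⟩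

theorem IsGlobalSolution.isSliceFlow {K : ℝ} {ω₀ : ℝ × ℝ → ℝ} (hw : IsWedgeVorticity K ω₀)
    {Φ : ℝ → ℝ → ℝ} (hΦ : IsGlobalSolution ω₀ Φ) :
    IsSliceFlow K ω₀ fun w s => w + Φ w (max s 0) := by
  obtain ⟨hcont, hbdd, heq⟩ := hΦ
  refine ⟨hw, ?_, fun z t ht => ?_, fun t ht => ?_⟩
  · refine continuous_fst.add ?_
    exact hcont.comp_continuous (f := fun p : ℝ × ℝ => (p.1, max p.2 0)) (by fun_prop)
      fun p => ⟨mem_univ _, mem_Ici.2 (le_max_right p.2 0)⟩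
  · simp only [max_eq_left ht]
    have hamp : ∀ s ∈ uIcc 0 t, ∫ w in Ioi z, ∫ z₂ : ℝ, ω₀ (w, z₂ - Φ w s) / cosh z₂ =
        4 * amplitude K ω₀ (fun w s => w + Φ w (max s 0)) z s := by
      intro s hs
      rw [uIcc_of_le ht] at hs
      rw [← hw.Omeg_eq_amplitude hs.1, Omeg]
      ring
    rw [heq z t ht, intervalIntegral.integral_congr hamp, intervalIntegral.integral_const_mul]
    ring
  · obtain ⟨M, hM⟩ := hbdd (max t 1) (by positivity)
    refine ⟨M, fun z => ?_⟩
    simp only [max_eq_left ht]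
    linarith [(abs_le.1 (hM z t ⟨ht, le_max_left _ _⟩)).2]

/-- Key proposition: if at a time `t₁ ≥ t₀` the amplitude at the forward front
`F₁(t₁)` equals `A₀ = 10000(B+K)²e^{2(B+K)}`, then with
`δt = 100(B+K)e^{B+K}/A₀ ≤ 1` one has `Ω(F₁(t₁+δt), t₁+δt) ≤ A₀/2` and
`Ω(-∞,t) ≤ 2A₀e^{B+K}` for all `t ∈ [t₁, t₁+δt]`. -/
theorem stmt_15 (K Z₁ c B t₀ : ℝ) (hK : 0 < K) (hc : 0 < c)
    (ω₀ : ℝ × ℝ → ℝ) (hC1 : ContDiff ℝ 1 ω₀)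
    (hrange : ∀ z, 0 ≤ ω₀ z ∧ ω₀ z ≤ 1)
    (hsupp : ∀ z : ℝ × ℝ, ω₀ z ≠ 0 → |z.1 - z.2| ≤ K ∧ z.1 + z.2 ≤ K)
    (hlow : ∀ w : ℝ, w ≤ Z₁ → c ≤ ∫ z₂ : ℝ, ω₀ (w, z₂))
    (Φ : ℝ → ℝ → ℝ) (hΦ : IsGlobalSolution ω₀ Φ)
    (hΦC1 : ∀ s : ℝ, 0 ≤ s → ContDiff ℝ 1 (fun w => Φ w s))
    (hB : max K 1 ≤ B)
    (hε : ((((c / 4) * Real.exp (-K - 1))⁻¹ + 2 * t₀) * Real.exp (K - B)) ≤ 0.1)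
    (ht₀ : 0 ≤ t₀)
    (F₁ : ℝ → ℝ)
    (hF₁ : ∀ t : ℝ, t₀ ≤ t → IsLeast {z₁ : ℝ | z₁ + Φ z₁ t = -B} (F₁ t))
    (hZ₁ : ∀ t : ℝ, t₀ ≤ t → 0 ≤ Z₁ + Φ Z₁ t)
    (A₀ : ℝ) (hA₀ : A₀ = 10000 * (B + K) ^ 2 * Real.exp (2 * (B + K)))
    (δt : ℝ) (hδt : δt = 100 * (B + K) * Real.exp (B + K) / A₀)
    (t₁ : ℝ) (ht₁ : t₀ ≤ t₁)
    (hΩt₁ : Omeg ω₀ Φ (F₁ t₁) t₁ = A₀) :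
    δt ≤ 1 ∧
    Omeg ω₀ Φ (F₁ (t₁ + δt)) (t₁ + δt) ≤ A₀ / 2 ∧
    ∀ t ∈ Set.Icc t₁ (t₁ + δt), OmegInf ω₀ Φ t ≤ 2 * A₀ * Real.exp (B + K) := by
  have hw : IsWedgeVorticity K ω₀ := ⟨hK, hC1.continuous, hrange, hsupp⟩
  have hH := hΦ.isSliceFlow hw
  have hf : IsFront K ω₀ (fun w s => w + Φ w (max s 0)) B t₀ F₁ := by
    refine hH.isFront hc hlow hB ht₀ hε (fun t ht => ?_) fun t ht => ?_
    · simpa only [max_eq_left (ht₀.trans ht)] using hF₁ t ht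
    · simpa only [max_eq_left (ht₀.trans ht)] using hZ₁ t ht
  have hB1 := hf.one_le
  have hE : 1 ≤ exp (B + K) := one_le_exp (by linarith)
  have hA : A₀ = 10000 * (B + K) ^ 2 * exp (B + K) ^ 2 := by
    rw [hA₀, ← exp_nat_mul]; norm_num
  have hBK : 1 ≤ B + K := by linarith
  have hA1 : 1 ≤ A₀ := by
    have h1 : 1 ≤ (B + K) ^ 2 := one_le_pow₀ hBK
    have h2 : 1 ≤ exp (B + K) ^ 2 := one_le_pow₀ hE
    have h3 := one_le_mul_of_one_le_of_one_le h1 h2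
    rw [hA]
    linarith
  have hδ0 : 0 ≤ δt := by
    rw [hδt]; positivity
  have hδA : δt * A₀ = 100 * (B + K) * exp (B + K) := by
    rw [hδt]; field_simp
  have hBKδ : (B + K) * δt ≤ 1 / 100 := by
    have h1 : (B + K) * δt = 1 / (100 * exp (B + K)) := by
      rw [hδt, hA]; field_simp; norm_num
    rw [h1]
    exact one_div_le_one_div_of_le (by norm_num) (by linarith)
  have hKδ : K * δt ≤ 1 / 100 :=
    (mul_le_mul_of_nonneg_right (by linarith) hδ0).trans hBKδ
  have ht₁0 : 0 ≤ t₁ := ht₀.trans ht₁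
  rw [hw.Omeg_eq_amplitude ht₁0] at hΩt₁
  refine ⟨?_, ?_, fun t ht => OmegInf_le (by positivity) fun z => ?_⟩
  · nlinarith
  · rw [hw.Omeg_eq_amplitude (by linarith)]
    exact hf.amplitude_front_le ht₁ hδ0 hKδ hA hδA hΩt₁ hA1
  · rw [hw.Omeg_eq_amplitude (ht₁0.trans ht.1)]
    exact hf.amplitude_le ht₁ hδ0 hKδ hΩt₁ hA1 ht
end

section
/- There is no function Φ : ℝ × [0,∞) → ℝ which is continuous, continuously differentiable in t and in z₁, bounded on ℝ × [0,T] for every T > 0, and satisfies for all z₁ ∈ ℝ and all t ≥ 0: Φ(z₁,t) = (1/2) ∫₀ᵗ ∫_{z₁}^{∞} ∫_{ℝ} [ f₁(z̃₁, z₂ − Φ(z̃₁,s)) · ∫₀ˢ e^{Φ(z̃₁,r)/2} dr ] / cosh(z₂) dz₂ dz̃₁ ds. (That is, every solution of the hyperbolic Boussinesq system with such data ρ₀ and ω₀ ≡ 0 blows up in finite time: sup_{z₁} Φ(z₁,t) becomes infinite at some finite time T_b.) -/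
open MeasureTheory Real

/-- The `z₂`-integral of the source, after recentring the density at `z₂ = w`. -/
noncomputable def densityKernel (K : ℝ) (ρ₀ : ℝ × ℝ → ℝ) (w v : ℝ) : ℝ :=
  ∫ x in (-K)..K, Real.exp (x / 2) * ρ₀ (w, w + x) / Real.cosh (w + x + v)

/-- The spatial density of the source driving the phase `Φ`. -/
noncomputable def phaseSource (K : ℝ) (ρ₀ : ℝ × ℝ → ℝ) (Φ : ℝ → ℝ → ℝ) (w s : ℝ) : ℝ :=
  densityKernel K ρ₀ w (Φ w s) * ∫ r in (0:ℝ)..s, Real.exp (Φ w r / 2)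

lemma continuous_densityKernel (K : ℝ) {ρ₀ : ℝ × ℝ → ℝ} (hρ : Continuous ρ₀) :
    Continuous fun p : ℝ × ℝ => densityKernel K ρ₀ p.1 p.2 := by
  unfold densityKernel
  apply intervalIntegral.continuous_parametric_intervalIntegral_of_continuous'
  simp only [Function.uncurry_def]
  exact Continuous.div (by fun_prop) (by fun_prop) fun _ => (Real.cosh_pos _).ne'

lemma continuous_phaseSource (K : ℝ) {ρ₀ : ℝ × ℝ → ℝ} (hρ : Continuous ρ₀) {Φ : ℝ → ℝ → ℝ}
    (hΦ : Continuous fun p : ℝ × ℝ => Φ p.1 p.2) :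
    Continuous fun p : ℝ × ℝ => phaseSource K ρ₀ Φ p.1 p.2 := by
  unfold phaseSource
  refine ((continuous_densityKernel K hρ).comp (continuous_fst.prodMk hΦ)).mul ?_
  apply intervalIntegral.continuous_parametric_intervalIntegral_of_continuous _ continuous_snd
  have : Continuous fun q : (ℝ × ℝ) × ℝ => Φ q.1.1 q.2 :=
    hΦ.comp (by fun_prop : Continuous fun q : (ℝ × ℝ) × ℝ => (q.1.1, q.2))
  simp only [Function.uncurry_def]
  fun_prop

lemma densityKernel_nonneg {K : ℝ} (hK : 0 ≤ K) {ρ₀ : ℝ × ℝ → ℝ} (hpos : ∀ z, 0 ≤ ρ₀ z)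
    (w v : ℝ) : 0 ≤ densityKernel K ρ₀ w v :=
  intervalIntegral.integral_nonneg (by linarith) fun _ _ =>
    div_nonneg (mul_nonneg (Real.exp_pos _).le (hpos _)) (Real.cosh_pos _).le

lemma densityKernel_eq_zero {K : ℝ} {ρ₀ : ℝ × ℝ → ℝ}
    (hsupp : ∀ z : ℝ × ℝ, ρ₀ z ≠ 0 → |z.1 - z.2| ≤ K ∧ z.1 + z.2 ≤ K) {w : ℝ} (hw : K < w)
    (v : ℝ) : densityKernel K ρ₀ w v = 0 := by
  have h : ∀ x, ρ₀ (w, w + x) = 0 := by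
    intro x
    by_contra hne
    obtain ⟨h₁, h₂⟩ := hsupp _ hne
    have := (abs_le.mp h₁).2
    simp only at this h₂
    linarith
  simp [densityKernel, h]

lemma integral_eq_intervalIntegral_of_support {K : ℝ} (hK : 0 ≤ K) {f : ℝ → ℝ}
    (hf : ∀ x, K < |x| → f x = 0) : ∫ x, f x = ∫ x in (-K)..K, f x := by
  rw [intervalIntegral.integral_of_le (by linarith), ← integral_Icc_eq_integral_Ioc,
    setIntegral_eq_integral_of_forall_compl_eq_zero]
  intro x hx
  apply hf
  by_contra! h
  exact hx (abs_le.mp h)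

lemma density_eq_zero_of_lt {K : ℝ} {ρ₀ : ℝ × ℝ → ℝ}
    (hsupp : ∀ z : ℝ × ℝ, ρ₀ z ≠ 0 → |z.1 - z.2| ≤ K ∧ z.1 + z.2 ≤ K) (w : ℝ) {x : ℝ}
    (hx : K < |x|) : ρ₀ (w, w + x) = 0 := by
  by_contra hne
  have h := (hsupp _ hne).1
  simp only [sub_add_cancel_left, abs_neg] at h
  linarith

lemma integral_eq_densityKernel_mul {K : ℝ} (hK : 0 ≤ K) {ρ₀ : ℝ × ℝ → ℝ}
    (hsupp : ∀ z : ℝ × ℝ, ρ₀ z ≠ 0 → |z.1 - z.2| ≤ K ∧ z.1 + z.2 ≤ K) (w v I : ℝ) :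
    ∫ z₂ : ℝ, (Real.exp ((z₂ - v - w) / 2) * ρ₀ (w, z₂ - v) * I) / Real.cosh z₂ =
      densityKernel K ρ₀ w v * I := by
  rw [← integral_add_right_eq_self _ (w + v), integral_eq_intervalIntegral_of_support hK,
    densityKernel, ← intervalIntegral.integral_mul_const]
  · apply intervalIntegral.integral_congr
    intro x _
    have h₁ : x + (w + v) - v - w = x := by ring
    have h₂ : x + (w + v) - v = w + x := by ring
    have h₃ : x + (w + v) = w + x + v := by ring
    dsimp only
    rw [h₁, h₂, h₃]
    ring
  · intro x hx
    have h₂ : x + (w + v) - v = w + x := by ring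
    simp only [h₂, density_eq_zero_of_lt hsupp w hx]
    simp

lemma le_densityKernel {K c : ℝ} (hK : 0 ≤ K) {ρ₀ : ℝ × ℝ → ℝ} (hρ : Continuous ρ₀)
    (hpos : ∀ z, 0 ≤ ρ₀ z)
    (hsupp : ∀ z : ℝ × ℝ, ρ₀ z ≠ 0 → |z.1 - z.2| ≤ K ∧ z.1 + z.2 ≤ K) {w v L : ℝ}
    (hlow : c ≤ ∫ z₂ : ℝ, Real.exp ((z₂ - w) / 2) * ρ₀ (w, z₂)) (hL : |w + v| ≤ L) :
    c / Real.cosh (L + K) ≤ densityKernel K ρ₀ w v := by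
  have hmass : ∫ z₂ : ℝ, Real.exp ((z₂ - w) / 2) * ρ₀ (w, z₂) =
      ∫ x in (-K)..K, Real.exp (x / 2) * ρ₀ (w, w + x) := by
    rw [← integral_add_left_eq_self _ w, integral_eq_intervalIntegral_of_support hK]
    · simp only [add_sub_cancel_left]
    · intro x hx
      simp [density_eq_zero_of_lt hsupp w hx]
  rw [hmass] at hlow
  refine (div_le_div_of_nonneg_right hlow (Real.cosh_pos _).le).trans ?_
  rw [← intervalIntegral.integral_div, densityKernel]
  apply intervalIntegral.integral_mono_on (by linarith)
  · exact Continuous.intervalIntegrable (by fun_prop) _ _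
  · exact Continuous.intervalIntegrable (Continuous.div (by fun_prop) (by fun_prop)
      fun _ => (Real.cosh_pos _).ne') _ _
  · intro x hx
    refine div_le_div_of_nonneg_left (mul_nonneg (Real.exp_pos _).le (hpos _))
      (Real.cosh_pos _) ?_
    rw [Real.cosh_le_cosh]
    have := abs_le.mp hL
    refine (abs_le.mpr ⟨?_, ?_⟩).trans (le_abs_self _) <;> linarith [hx.1, hx.2]

lemma mul_exp_le_integral_exp {φ : ℝ → ℝ} (hφ : Continuous φ) {a T s : ℝ} (hT : 0 ≤ T)
    (hs : T ≤ s) (ha : ∀ r, T ≤ r → a ≤ φ r) :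
    (s - T) * Real.exp (a / 2) ≤ ∫ r in (0:ℝ)..s, Real.exp (φ r / 2) := by
  have hc : Continuous fun r => Real.exp (φ r / 2) := by fun_prop
  rw [← intervalIntegral.integral_add_adjacent_intervals (hc.intervalIntegrable 0 T)
    (hc.intervalIntegrable T s)]
  have h₁ : 0 ≤ ∫ r in (0:ℝ)..T, Real.exp (φ r / 2) :=
    intervalIntegral.integral_nonneg hT fun _ _ => (Real.exp_pos _).le
  have h₂ : ∫ _ in T..s, Real.exp (a / 2) ≤ ∫ r in T..s, Real.exp (φ r / 2) := by
    refine intervalIntegral.integral_mono_on hs intervalIntegrable_const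
      (hc.intervalIntegrable _ _) fun r hr => Real.exp_le_exp.mpr ?_
    linarith [ha r hr.1]
  rw [intervalIntegral.integral_const, smul_eq_mul] at h₂
  linarith

lemma integral_rect_le {G : ℝ → ℝ → ℝ} (hG : Continuous fun p : ℝ × ℝ => G p.1 p.2)
    (hG0 : ∀ w s, 0 ≤ s → 0 ≤ G w s) {K z z' t t' : ℝ} (hz : z' ≤ z) (hzK : z ≤ K)
    (ht : 0 ≤ t) (htt' : t ≤ t') :
    ∫ s in (0:ℝ)..t, ∫ w in z..K, G w s ≤ ∫ s in (0:ℝ)..t', ∫ w in z'..K, G w s := by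
  have hc : ∀ y, Continuous fun s => ∫ w in y..K, G w s := fun y =>
    intervalIntegral.continuous_parametric_intervalIntegral_of_continuous'
      (f := fun s w => G w s) (hG.comp continuous_swap) y K
  have hslice : ∀ s, Continuous fun w => G w s := fun s =>
    hG.comp (by fun_prop : Continuous fun w : ℝ => (w, s))
  refine (intervalIntegral.integral_mono_on ht ((hc z).intervalIntegrable _ _)
    ((hc z').intervalIntegrable _ _) fun s hs => ?_).trans ?_
  · exact intervalIntegral.integral_mono_interval hz hzK le_rfl
      (Filter.Eventually.of_forall fun w => hG0 w s hs.1)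
      ((hslice s).intervalIntegrable _ _)
  · rw [← intervalIntegral.integral_add_adjacent_intervals ((hc z').intervalIntegrable 0 t)
      ((hc z').intervalIntegrable t t')]
    refine le_add_of_nonneg_right (intervalIntegral.integral_nonneg htt' fun s hs => ?_)
    exact intervalIntegral.integral_nonneg (hz.trans hzK) fun w _ => hG0 w s (ht.trans hs.1)

lemma add_le_integral_rect {G : ℝ → ℝ → ℝ} (hG : Continuous fun p : ℝ × ℝ => G p.1 p.2)
    (hG0 : ∀ w s, 0 ≤ s → 0 ≤ G w s) {K z p t τ g : ℝ} (hz : z ≤ p - 1) (hpK : p ≤ K)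
    (ht : 0 ≤ t) (hτ : 0 ≤ τ)
    (hg : ∀ w ∈ Set.Icc (p - 1) p, ∀ s ∈ Set.Icc t (t + τ), g ≤ G w s) :
    (∫ s in (0:ℝ)..t, ∫ w in z..K, G w s) + τ * g ≤
      ∫ s in (0:ℝ)..(t + τ), ∫ w in z..K, G w s := by
  have hc : Continuous fun s => ∫ w in z..K, G w s :=
    intervalIntegral.continuous_parametric_intervalIntegral_of_continuous'
      (f := fun s w => G w s) (hG.comp continuous_swap) z K
  have hslice : ∀ s, Continuous fun w => G w s := fun s =>
    hG.comp (by fun_prop : Continuous fun w : ℝ => (w, s))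
  rw [← intervalIntegral.integral_add_adjacent_intervals (hc.intervalIntegrable 0 t)
    (hc.intervalIntegrable t (t + τ))]
  have h : ∫ _ in t..(t + τ), g ≤ ∫ s in t..(t + τ), ∫ w in z..K, G w s := by
    refine intervalIntegral.integral_mono_on (by linarith) intervalIntegrable_const
      (hc.intervalIntegrable _ _) fun s hs => ?_
    have h₁ : ∫ _ in (p - 1)..p, g ≤ ∫ w in (p - 1)..p, G w s :=
      intervalIntegral.integral_mono_on (by linarith) intervalIntegrable_const
        ((hslice s).intervalIntegrable _ _) fun w hw => hg w hw s hs
    have h₂ : ∫ w in (p - 1)..p, G w s ≤ ∫ w in z..K, G w s :=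
      intervalIntegral.integral_mono_interval hz (by linarith) hpK
        (Filter.Eventually.of_forall fun w => hG0 w s (ht.trans hs.1))
        ((hslice s).intervalIntegrable _ _)
    rw [intervalIntegral.integral_const, smul_eq_mul] at h₁
    linarith
  rw [intervalIntegral.integral_const, smul_eq_mul] at h
  linarith

/-- Continuous phases solving a source equation of this form cannot be bounded on strips:
the level `n` is reached on `(-∞, -n]` at times with geometrically summable increments. -/
theorem not_bounded_of_phase_eq {K Z₂ c : ℝ} (hK : 0 ≤ K) (hc : 0 < c) {Φ G : ℝ → ℝ → ℝ}
    (hG : Continuous fun p : ℝ × ℝ => G p.1 p.2) (hG0 : ∀ w s, 0 ≤ s → 0 ≤ G w s)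
    (hΦ : ∀ z t, z ≤ K → 0 ≤ t → Φ z t = (1 / 2) * ∫ s in (0:ℝ)..t, ∫ w in z..K, G w s)
    (hlow : ∀ w T s a L, w ≤ Z₂ → 0 ≤ T → T ≤ s → (∀ r, T ≤ r → a ≤ Φ w r) →
      |w + Φ w s| ≤ L → c / Real.cosh (L + K) * ((s - T) * Real.exp (a / 2)) ≤ G w s) :
    ¬ ∀ T : ℝ, 0 < T → ∃ M, ∀ z : ℝ, ∀ t ∈ Set.Icc (0:ℝ) T, |Φ z t| ≤ M := by
  intro hbd
  have hmono : ∀ {z z' t t'}, z' ≤ z → z ≤ K → 0 ≤ t → t ≤ t' → Φ z t ≤ Φ z' t' := by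
    intro z z' t t' hz hzK ht htt'
    rw [hΦ z t hzK ht, hΦ z' t' (hz.trans hzK) (ht.trans htt')]
    linarith [integral_rect_le hG hG0 hz hzK ht htt']
  have hstep : ∀ p a L τ T, p ≤ 0 → p ≤ Z₂ → 0 ≤ T → 0 ≤ τ → 1 ≤ L → -L ≤ p - 1 + a →
      1 - p - a ≤ 1 / 2 * (c / Real.cosh (L + K)) * Real.exp (a / 2) * τ ^ 2 →
      (∀ z ≤ p, ∀ t ≥ T, a ≤ Φ z t) → ∀ z ≤ p - 1, ∀ t ≥ T + 2 * τ, 1 - p ≤ Φ z t := by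
    intro p a L τ T hp0 hpZ hT hτ hL1 hLp hgain ha z hz t ht
    refine le_trans ?_ (hmono le_rfl (by linarith) (by linarith : 0 ≤ T + 2 * τ) ht)
    by_cases hcase : ∃ w ∈ Set.Icc (p - 1) p, ∃ s ∈ Set.Icc T (T + 2 * τ), 1 - p ≤ Φ w s
    · obtain ⟨w, hw, s, hs, h⟩ := hcase
      exact h.trans (hmono (hz.trans hw.1) (by linarith [hw.2]) (hT.trans hs.1) hs.2)
    · push Not at hcase
      have key := add_le_integral_rect hG hG0 (K := K) (t := T + τ) (τ := τ)
        (g := c / Real.cosh (L + K) * (τ * Real.exp (a / 2))) hz (by linarith) (by linarith) hτ ?_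
      · have h₁ := ha z (by linarith) (T + τ) (by linarith)
        rw [hΦ z _ (by linarith) (by linarith)] at h₁ ⊢
        rw [show T + 2 * τ = T + τ + τ by ring]
        linarith
      · intro w hw s hs
        refine le_trans ?_ (hlow w T s a L (hw.2.trans hpZ) hT (by linarith [hs.1])
          (fun r hr => ha w hw.2 r hr) (abs_le.mpr ⟨?_, ?_⟩))
        · have := Real.cosh_pos (L + K)
          have : τ ≤ s - T := by linarith [hs.1]
          gcongr
        · linarith [ha w hw.2 s (by linarith [hs.1]), hw.1]
        · linarith [hcase w hw s ⟨by linarith [hs.1], by linarith [hs.2]⟩, hw.2]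
  have hnonneg : ∀ z t, z ≤ K → 0 ≤ t → 0 ≤ Φ z t := by
    intro z t hz ht
    have h₀ : Φ z 0 = 0 := by rw [hΦ z 0 hz le_rfl]; simp
    exact h₀ ▸ hmono le_rfl hz le_rfl ht
  have hgain : ∀ L b, 0 ≤ b → ∃ τ, 0 ≤ τ ∧ b = 1 / 2 * (c / Real.cosh (L + K)) * τ ^ 2 := by
    intro L b hb
    have hκ : 0 < 1 / 2 * (c / Real.cosh (L + K)) := by
      have := Real.cosh_pos (L + K)
      positivity
    refine ⟨√(b / (1 / 2 * (c / Real.cosh (L + K)))), Real.sqrt_nonneg _, ?_⟩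
    rw [Real.sq_sqrt (by positivity), mul_div_cancel₀ _ hκ.ne']
  obtain ⟨p, hp0, hpZ⟩ : ∃ p : ℝ, p ≤ 0 ∧ p ≤ Z₂ := ⟨min 0 Z₂, min_le_left _ _, min_le_right _ _⟩
  obtain ⟨τ₀, hτ₀, hτ₀'⟩ := hgain (1 - p) (1 - p) (by linarith)
  have hbase := hstep p 0 (1 - p) τ₀ 0 hp0 hpZ le_rfl hτ₀ (by linarith) (by linarith)
    (by simpa using hτ₀'.le) fun z hz t ht => hnonneg z t (by linarith) ht
  obtain ⟨A, hA, hA'⟩ := hgain 1 1 zero_le_one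
  set q : ℝ := Real.exp (-(1 / 4)) with hq
  have hq0 : 0 < q := Real.exp_pos _
  have hq1 : q < 1 := by rw [hq, Real.exp_lt_one_iff]; norm_num
  set C : ℝ := 2 * A / (1 - q) with hC
  have hC' : C * (1 - q) = 2 * A := div_mul_cancel₀ _ (by linarith)
  have hC0 : 0 ≤ C := div_nonneg (by linarith) (by linarith)
  have hlevel : ∀ n : ℕ, ∀ z ≤ p - 1 - n, ∀ t ≥ 2 * τ₀ + C * (1 - q ^ n),
      1 - p + n ≤ Φ z t := by
    intro n
    induction n with
    | zero => simpa using hbase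
    | succ n ih =>
      have hqn : q ^ n ≤ 1 := pow_le_one₀ hq0.le hq1.le
      have hqn0 : 0 < q ^ n := pow_pos hq0 n
      have hsq : Real.exp ((n : ℝ) / 2) * (q ^ n) ^ 2 = 1 := by
        rw [hq, ← Real.exp_nat_mul, ← Real.exp_nat_mul, ← Real.exp_add, Real.exp_eq_one_iff]
        push_cast
        ring
      have hn : (0 : ℝ) ≤ n := n.cast_nonneg
      have h := hstep (p - 1 - n) (1 - p + n) 1 (A * q ^ n) (2 * τ₀ + C * (1 - q ^ n))
        (by linarith) (by linarith) (by nlinarith) (by positivity) le_rfl (by linarith) ?_ ih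
      · intro z hz t ht
        push_cast at hz ⊢
        have := h z (by linarith) t (ge_iff_le.mpr (le_trans (le_of_eq ?_) ht))
        · linarith
        · rw [pow_succ]
          linear_combination -(q ^ n) * hC'
      · have hexp : Real.exp ((n : ℝ) / 2) ≤ Real.exp ((1 - p + n) / 2) :=
          Real.exp_le_exp.mpr (by linarith)
        have hκ : 0 ≤ 1 / 2 * (c / Real.cosh (1 + K)) := by
          have := Real.cosh_pos (1 + K)
          positivity
        calc 1 - (p - 1 - (n : ℝ)) - (1 - p + n)
            = 1 / 2 * (c / Real.cosh (1 + K)) * Real.exp ((n : ℝ) / 2) * (A * q ^ n) ^ 2 := by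
              linear_combination hA' -
                1 / 2 * (c / Real.cosh (1 + K)) * A ^ 2 * hsq
          _ ≤ _ := by gcongr
  obtain ⟨M, hM⟩ := hbd (2 * τ₀ + C + 1) (by linarith)
  obtain ⟨n, hn⟩ := exists_nat_gt M
  have h₁ := hlevel n (p - 1 - n) le_rfl (2 * τ₀ + C) (by nlinarith [pow_pos hq0 n])
  have h₂ := (le_abs_self _).trans (hM (p - 1 - n) (2 * τ₀ + C) ⟨by linarith, by linarith⟩)
  linarith

/-- Finite time blow up for the hyperbolic Boussinesq system with `ω₀ ≡ 0`:
with `f₁(z₁,z₂) = e^{(z₂-z₁)/2}ρ₀(z₁,z₂)`, no globally regular phase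
`Φ : ℝ × [0,∞) → ℝ` can satisfy
`Φ(z₁,t) = (1/2)∫₀ᵗ∫_{z₁}^∞∫_ℝ [f₁(z̃₁, z₂-Φ(z̃₁,s)) ∫₀ˢ e^{Φ(z̃₁,r)/2} dr]/cosh(z₂)`
for all `z₁ ∈ ℝ` and `t ≥ 0`. -/
theorem stmt_16 (K Z₂ c : ℝ) (hK : 0 < K) (hc : 0 < c)
    (ρ₀ : ℝ × ℝ → ℝ) (hC1 : ContDiff ℝ 1 ρ₀) (hpos : ∀ z, 0 ≤ ρ₀ z)
    (hbdd : ∃ M, ∀ z, |ρ₀ z| ≤ M)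
    (hsupp : ∀ z : ℝ × ℝ, ρ₀ z ≠ 0 → |z.1 - z.2| ≤ K ∧ z.1 + z.2 ≤ K)
    (hlow : ∀ z₁ : ℝ, z₁ ≤ Z₂ →
      c ≤ ∫ z₂ : ℝ, Real.exp ((z₂ - z₁) / 2) * ρ₀ (z₁, z₂)) :
    ¬ ∃ Φ : ℝ → ℝ → ℝ,
        ContinuousOn (fun p : ℝ × ℝ => Φ p.1 p.2) (Set.univ ×ˢ Set.Ici (0:ℝ)) ∧
        (∀ z₁ : ℝ, ContDiffOn ℝ 1 (fun s => Φ z₁ s) (Set.Ici (0:ℝ))) ∧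
        (∀ t : ℝ, 0 ≤ t → ContDiff ℝ 1 (fun z₁ => Φ z₁ t)) ∧
        (∀ T : ℝ, 0 < T → ∃ M, ∀ z₁ : ℝ, ∀ t ∈ Set.Icc (0:ℝ) T, |Φ z₁ t| ≤ M) ∧
        (∀ (z₁ t : ℝ), 0 ≤ t →
          Φ z₁ t = (1 / 2) * ∫ s in (0:ℝ)..t, ∫ w in Set.Ioi z₁, ∫ z₂ : ℝ,
            (Real.exp ((z₂ - Φ w s - w) / 2) * ρ₀ (w, z₂ - Φ w s) *
              ∫ r in (0:ℝ)..s, Real.exp (Φ w r / 2)) / Real.cosh z₂) := by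
  rintro ⟨Φ, hcont, -, -, hbd, heq⟩
  set Ψ : ℝ → ℝ → ℝ := fun w s => Φ w (max s 0) with hΨ
  have hΨΦ : ∀ w s, 0 ≤ s → Ψ w s = Φ w s := fun w s hs => by simp [hΨ, max_eq_left hs]
  have hΨc : Continuous fun p : ℝ × ℝ => Ψ p.1 p.2 :=
    hcont.comp_continuous (by fun_prop : Continuous fun p : ℝ × ℝ => (p.1, max p.2 0))
      fun p => ⟨Set.mem_univ _, le_max_right p.2 0⟩
  have hΨw : ∀ w, Continuous (Ψ w) := fun w =>
    hΨc.comp (by fun_prop : Continuous fun r : ℝ => (w, r))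
  refine not_bounded_of_phase_eq (Φ := Ψ) (G := phaseSource K ρ₀ Ψ) (Z₂ := Z₂) hK.le hc
    (continuous_phaseSource K hC1.continuous hΨc) ?_ ?_ ?_ ?_
  · intro w s hs
    exact mul_nonneg (densityKernel_nonneg hK.le hpos _ _)
      (intervalIntegral.integral_nonneg hs fun _ _ => (Real.exp_pos _).le)
  · intro z t hz ht
    rw [hΨΦ z t ht, heq z t ht]
    congr 1
    apply intervalIntegral.integral_congr
    intro s hs
    rw [Set.uIcc_of_le ht] at hs
    have hsource : ∀ w, ∫ z₂ : ℝ, (Real.exp ((z₂ - Φ w s - w) / 2) * ρ₀ (w, z₂ - Φ w s) *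
        ∫ r in (0:ℝ)..s, Real.exp (Φ w r / 2)) / Real.cosh z₂ = phaseSource K ρ₀ Ψ w s := by
      intro w
      rw [integral_eq_densityKernel_mul hK.le hsupp, phaseSource, hΨΦ w s hs.1]
      congr 1
      apply intervalIntegral.integral_congr
      intro r hr
      rw [Set.uIcc_of_le hs.1] at hr
      simp only [hΨΦ w r hr.1]
    simp only [hsource]
    rw [intervalIntegral.integral_of_le hz]
    refine setIntegral_eq_of_subset_of_forall_sdiff_eq_zero measurableSet_Ioi
      Set.Ioc_subset_Ioi_self fun w hw => ?_
    have hKw : K < w := not_le.mp fun h => hw.2 ⟨hw.1, h⟩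
    rw [phaseSource, densityKernel_eq_zero hsupp hKw, zero_mul]
  · intro w T s a L hw hT hs ha hL
    exact mul_le_mul (le_densityKernel hK.le hC1.continuous hpos hsupp (hlow w hw) hL)
      (mul_exp_le_integral_exp (hΨw w) hT hs ha)
      (mul_nonneg (by linarith) (Real.exp_pos _).le) (densityKernel_nonneg hK.le hpos _ _)
  · intro T hT
    obtain ⟨M, hM⟩ := hbd T hT
    exact ⟨M, fun z t ht => (hΨΦ z t ht.1).symm ▸ hM z t ht⟩
end

section
/- For every t ∈ [t₂, T), every z₁ ∈ [F₂(t), F₂(t)+1], and every s with t₂ ≤ s ≤ t: Φ(z₁,s) ≥ |F₂(s)|/2. -/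
open MeasureTheory Real

/-- To the right of the largest zero of `z + φ z`, with `φ` continuous and nonnegative,
the function `z + φ z` is nonnegative. -/
lemma add_nonneg_of_isGreatest_zero_lt {φ : ℝ → ℝ} (hφ : Continuous φ) (hpos : ∀ z, 0 ≤ φ z)
    {m z : ℝ} (hm : IsGreatest {x : ℝ | x + φ x = 0} m) (hz : m < z) : 0 ≤ z + φ z := by
  by_contra! hneg
  have hz0 : z ≤ 0 := by linarith [hpos z]
  obtain ⟨c, hc, hc0⟩ := intermediate_value_Icc hz0
    (continuous_id.add hφ).continuousOn ⟨hneg.le, by simpa using hpos 0⟩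
  exact absurd (hm.2 hc0) (not_le.2 (hz.trans_le hc.1))

/-- For every `t ∈ [t₂,T)`, every `z₁ ∈ [F₂(t), F₂(t)+1]` and every `s ∈ [t₂,t]`:
`Φ(z₁,s) ≥ |F₂(s)|/2`, where `F₂(t)` is the largest zero of `H(·,t) = · + Φ(·,t)`. -/
theorem stmt_17 (t₂ : ℝ) (T : EReal) (ht₂ : 0 ≤ t₂) (hT : (t₂ : EReal) < T)
    (Φ : ℝ → ℝ → ℝ)
    (hpos : ∀ (z₁ t : ℝ), t₂ ≤ t → (t : EReal) < T → 0 ≤ Φ z₁ t)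
    (hcont : ∀ t : ℝ, t₂ ≤ t → (t : EReal) < T → Continuous (fun z₁ => Φ z₁ t))
    (hanti : ∀ t : ℝ, t₂ ≤ t → (t : EReal) < T →
      ∀ a b : ℝ, a ≤ b → Φ b t ≤ Φ a t)
    (F₂ : ℝ → ℝ)
    (hF₂ : ∀ t : ℝ, t₂ ≤ t → (t : EReal) < T →
      IsGreatest {z₁ : ℝ | z₁ + Φ z₁ t = 0} (F₂ t))
    (hmono : ∀ s t : ℝ, t₂ ≤ s → s ≤ t → (t : EReal) < T → F₂ t ≤ F₂ s)
    (hinit : F₂ t₂ ≤ -10) :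
    ∀ t : ℝ, t₂ ≤ t → (t : EReal) < T →
      ∀ z₁ ∈ Set.Icc (F₂ t) (F₂ t + 1),
        ∀ s : ℝ, t₂ ≤ s → s ≤ t → |F₂ s| / 2 ≤ Φ z₁ s := by
  intro t ht htT z₁ hz s hs hst
  have hsT : (s : EReal) < T := (EReal.coe_le_coe_iff.2 hst).trans_lt htT
  have hF := hF₂ s hs hsT
  have hzero : F₂ s + Φ (F₂ s) s = 0 := hF.1
  have hle : F₂ s ≤ -10 := (hmono t₂ s le_rfl hs hsT).trans hinit
  rw [abs_of_nonpos (by linarith)]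
  rcases le_or_gt z₁ (F₂ s) with h | h
  · linarith [hanti s hs hsT z₁ (F₂ s) h]
  · have hH := add_nonneg_of_isGreatest_zero_lt (hcont s hs hsT) (fun z => hpos z s hs hsT) hF h
    linarith [hz.2, hmono s t hs hst htT]
end

section
/- Suppose ω : (0,∞)² → ℝ is measurable, 0 ≤ ω(x) ≤ A · min(1, x₂) for all x, and ω(x) = 0 whenever x₁ > R. Then ∫_{(0,∞)²} ω(x)/(x₁² + x₂²) dx ≤ A (π/2 + R). (In particular, for solutions of the hyperbolic 2D Euler equation whose initial vorticity is C¹ and vanishes on the boundary of the quadrant, the velocity amplitude Ω(0,t) = ∫_{(0,∞)²} ω(x,t)/|x|² dx is bounded uniformly in time by a constant depending only on the initial data.) -/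
open MeasureTheory Real

/-- The horizontal integral of the Poisson kernel over a half-line. -/
lemma lintegral_Ioi_mul_div_sq_add_sq {A y : ℝ} (hA : 0 ≤ A) (hy : 0 < y) :
    ∫⁻ x in Set.Ioi (0 : ℝ), ENNReal.ofReal (A * y / (x ^ 2 + y ^ 2)) =
      ENNReal.ofReal (A * (π / 2)) := by
  have hderiv : ∀ x ∈ Set.Ici (0 : ℝ),
      HasDerivAt (fun x => A * arctan (x / y)) (A * y / (x ^ 2 + y ^ 2)) x := by
    intro x _
    refine ((((hasDerivAt_id x).div_const y).arctan).const_mul A).congr_deriv ?_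
    simp only [id]
    field_simp
    ring
  have hnonneg : ∀ x ∈ Set.Ioi (0 : ℝ), 0 ≤ A * y / (x ^ 2 + y ^ 2) := fun x _ => by positivity
  have hlim : Filter.Tendsto (fun x => A * arctan (x / y)) Filter.atTop (nhds (A * (π / 2))) :=
    ((tendsto_arctan_atTop.mono_right nhdsWithin_le_nhds).comp
      (Filter.tendsto_id.atTop_div_const hy)).const_mul A
  rw [← ofReal_integral_eq_lintegral_ofReal
    (integrableOn_Ioi_deriv_of_nonneg' hderiv hnonneg hlim)
    (ae_restrict_of_forall_mem measurableSet_Ioi hnonneg),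
    integral_Ioi_of_hasDerivAt_of_nonneg' hderiv hnonneg hlim]
  simp

lemma lintegral_Ioi_one_const_div_sq {c : ℝ} (hc : 0 ≤ c) :
    ∫⁻ y in Set.Ioi (1 : ℝ), ENNReal.ofReal (c / y ^ 2) = ENNReal.ofReal c := by
  have hderiv : ∀ y ∈ Set.Ici (1 : ℝ), HasDerivAt (fun y => -c * y⁻¹) (c / y ^ 2) y := by
    intro y hy
    have hy0 : y ≠ 0 := (zero_lt_one.trans_le hy).ne'
    refine ((hasDerivAt_inv hy0).const_mul (-c)).congr_deriv ?_
    field_simp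
  have hnonneg : ∀ y ∈ Set.Ioi (1 : ℝ), 0 ≤ c / y ^ 2 := fun y _ => by positivity
  have hlim : Filter.Tendsto (fun y : ℝ => -c * y⁻¹) Filter.atTop (nhds (-c * 0)) :=
    tendsto_inv_atTop_zero.const_mul (-c)
  rw [← ofReal_integral_eq_lintegral_ofReal
    (integrableOn_Ioi_deriv_of_nonneg' hderiv hnonneg hlim)
    (ae_restrict_of_forall_mem measurableSet_Ioi hnonneg),
    integral_Ioi_of_hasDerivAt_of_nonneg' hderiv hnonneg hlim]
  simp

/-- If `0 ≤ ω(x) ≤ A·min(1,x₂)` on the open quadrant and `ω` vanishes for `x₁ > R`,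
then `∫ ω(x)/|x|² dx ≤ A(π/2 + R)`. -/
theorem stmt_18 (A R : ℝ) (hA : 0 ≤ A) (hR : 0 < R) (ω : ℝ × ℝ → ℝ)
    (hmeas : Measurable ω)
    (hbound : ∀ x : ℝ × ℝ, 0 < x.1 → 0 < x.2 → 0 ≤ ω x ∧ ω x ≤ A * min 1 x.2)
    (hsupp : ∀ x : ℝ × ℝ, R < x.1 → ω x = 0) :
    ∫ x in Set.Ioi (0:ℝ) ×ˢ Set.Ioi (0:ℝ), ω x / (x.1 ^ 2 + x.2 ^ 2) ≤
      A * (π / 2 + R) := by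
  have hf : Measurable fun x : ℝ × ℝ => ω x / (x.1 ^ 2 + x.2 ^ 2) := by fun_prop
  have hnear : ∀ y ∈ Set.Ioc (0 : ℝ) 1,
      ∫⁻ x in Set.Ioi (0 : ℝ), ENNReal.ofReal (ω (x, y) / (x ^ 2 + y ^ 2)) ≤
        ENNReal.ofReal (A * (π / 2)) := by
    intro y hy
    rw [← lintegral_Ioi_mul_div_sq_add_sq hA hy.1]
    refine setLIntegral_mono' measurableSet_Ioi fun x hx => ENNReal.ofReal_le_ofReal ?_
    have h := (hbound (x, y) hx hy.1).2
    rw [min_eq_right hy.2] at h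
    gcongr
  have hfar : ∀ y ∈ Set.Ioi (1 : ℝ),
      ∫⁻ x in Set.Ioi (0 : ℝ), ENNReal.ofReal (ω (x, y) / (x ^ 2 + y ^ 2)) ≤
        ENNReal.ofReal (A * R / y ^ 2) := by
    intro y hy
    have hy1 : 1 < y := hy
    have hy0 : 0 < y := zero_lt_one.trans hy1
    calc ∫⁻ x in Set.Ioi (0 : ℝ), ENNReal.ofReal (ω (x, y) / (x ^ 2 + y ^ 2))
        ≤ ∫⁻ x in Set.Ioi (0 : ℝ),
            (Set.Iic R).indicator (fun _ => ENNReal.ofReal (A / y ^ 2)) x := by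
          refine setLIntegral_mono' measurableSet_Ioi fun x hx => ?_
          by_cases hxR : x ≤ R
          · rw [Set.indicator_of_mem (Set.mem_Iic.2 hxR)]
            have h := (hbound (x, y) hx hy0).2
            rw [min_eq_left hy1.le, mul_one] at h
            refine ENNReal.ofReal_le_ofReal ?_
            gcongr
            exact le_add_of_nonneg_left (sq_nonneg x)
          · simp [hsupp (x, y) (not_le.1 hxR)]
      _ = ENNReal.ofReal (A * R / y ^ 2) := by
          rw [lintegral_indicator_const measurableSet_Iic,
            Measure.restrict_apply measurableSet_Iic, Set.inter_comm, Set.Ioi_inter_Iic,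
            Real.volume_Ioc, ← ENNReal.ofReal_mul (by positivity)]
          congr 1
          ring
  rw [integral_eq_lintegral_of_nonneg_ae
    (ae_restrict_of_forall_mem (measurableSet_Ioi.prod measurableSet_Ioi) fun x hx =>
      div_nonneg (hbound x hx.1 hx.2).1 (by positivity)) hf.aestronglyMeasurable]
  refine ENNReal.toReal_le_of_le_ofReal (by positivity) ?_
  rw [Measure.volume_eq_prod, ← Measure.prod_restrict,
    lintegral_prod_symm' _ hf.ennreal_ofReal, ← Set.Ioc_union_Ioi_eq_Ioi zero_le_one,
    lintegral_union measurableSet_Ioi (Set.Ioc_disjoint_Ioi le_rfl), mul_add,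
    ENNReal.ofReal_add (by positivity) (by positivity), Set.Ioc_union_Ioi_eq_Ioi zero_le_one]
  refine add_le_add ((setLIntegral_mono' measurableSet_Ioc hnear).trans ?_)
    ((setLIntegral_mono' measurableSet_Ioi hfar).trans ?_)
  · simp
  · exact (lintegral_Ioi_one_const_div_sq (by positivity)).le
end
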